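/- arXiv:2002.02578 — 2 statements merged into one kernel-verified Lean document; each statement's English description precedes it below -/
import Mathlib

section
/- Let H be a fixed graph and β > 0. Then there exist C, ε > 0 and a positive integer n₀ such that |𝒢*(H, n, m, ε)| ≤ β^m · C(n², m)^{e(H)} for every n ≥ n₀ and every m ≥ C·n^{2 − 1/m₂(H)}, where C(n², m) denotes the binomial coefficient 'n² choose m'. -/
/-!
Statement 4 (Balogh–Morris–Samotij / Saxton–Thomason, KŁR conjecture):
for every fixed graph `H` and `β > 0` there are `C, ε > 0` and `n₀` such that
`|𝒢*(H,n,m,ε)| ≤ β^m · (n² choose m)^{e(H)}` for all `n ≥ n₀` and `m ≥ C n^{2-1/m₂(H)}`.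
-/

open Finset
open scoped Classical

/-- `e_G(X)`: the number of edges of `G` with both endpoints in `X`. -/
noncomputable def eWithin {V : Type} [Fintype V] [DecidableEq V] (G : SimpleGraph V)
    (X : Finset V) : ℕ :=
  (G.edgeFinset.filter (fun e => ∀ v ∈ e, v ∈ X)).card

/-- `e_G(X,Y)`: the number of edges of `G` with one endpoint in `X` and the other in `Y`
(for disjoint `X`, `Y`). -/
noncomputable def eBetween {V : Type} [Fintype V] [DecidableEq V] (G : SimpleGraph V)
    (X Y : Finset V) : ℕ :=
  (G.edgeFinset.filter (fun e => ∃ x ∈ X, ∃ y ∈ Y, e = s(x, y))).card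

/-- The density `e(V₁,V₂)/(|V₁||V₂|)` of the pair `(V₁, V₂)` in `G`. -/
noncomputable def pairDensity {V : Type} [Fintype V] [DecidableEq V] (G : SimpleGraph V)
    (V₁ V₂ : Finset V) : ℝ :=
  (eBetween G V₁ V₂ : ℝ) / ((V₁.card : ℝ) * (V₂.card : ℝ))

/-- The pair `(V₁, V₂)` is `(ε)`-regular in `G`: for all `Vᵢ' ⊆ Vᵢ` with `|Vᵢ'| ≥ ε|Vᵢ|`
we have `|e(V₁',V₂') − |V₁'||V₂'|p| ≤ ε|V₁'||V₂'|p`, where `p = e(V₁,V₂)/(|V₁||V₂|)`. -/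
def EpsRegular {V : Type} [Fintype V] [DecidableEq V] (G : SimpleGraph V)
    (V₁ V₂ : Finset V) (ε : ℝ) : Prop :=
  ∀ V₁' ⊆ V₁, ∀ V₂' ⊆ V₂,
    ε * (V₁.card : ℝ) ≤ (V₁'.card : ℝ) → ε * (V₂.card : ℝ) ≤ (V₂'.card : ℝ) →
    |(eBetween G V₁' V₂' : ℝ) - (V₁'.card : ℝ) * (V₂'.card : ℝ) * pairDensity G V₁ V₂| ≤
      ε * ((V₁'.card : ℝ) * (V₂'.card : ℝ) * pairDensity G V₁ V₂)

/-- The `i`-th part `V_i` (of size `n`) of the canonical vertex set `Fin k × Fin n`. -/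
def part {k n : ℕ} (i : Fin k) : Finset (Fin k × Fin n) :=
  Finset.univ.filter (fun x => x.1 = i)

/-- The family `𝒢(H, n, m, ε)`: graphs on the disjoint union `V₁ ∪ … ∪ V_k` of sets of
size `n` whose edges run only between pairs `(V_i, V_j)` with `ij ∈ E(H)`, and which for
each edge `ij ∈ E(H)` induce an `(ε)`-regular bipartite graph with exactly `m` edges
between `V_i` and `V_j`. -/
def GFamily {k : ℕ} (H : SimpleGraph (Fin k)) (n m : ℕ) (ε : ℝ) :
    Set (SimpleGraph (Fin k × Fin n)) :=
  { G | (∀ a b : Fin k × Fin n, G.Adj a b → H.Adj a.1 b.1) ∧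
        (∀ i j : Fin k, H.Adj i j →
          eBetween G (part i) (part j) = m ∧ EpsRegular G (part i) (part j) ε) }

/-- `G` contains a copy of `H` (a subgraph isomorphic to `H`). -/
def ContainsCopy {V W : Type} (H : SimpleGraph V) (G : SimpleGraph W) : Prop :=
  ∃ f : V → W, Function.Injective f ∧ ∀ a b : V, H.Adj a b → G.Adj (f a) (f b)

/-- The family `𝒢*(H, n, m, ε)` of members of `𝒢(H, n, m, ε)` containing no copy of `H`. -/
def GStarFamily {k : ℕ} (H : SimpleGraph (Fin k)) (n m : ℕ) (ε : ℝ) :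
    Set (SimpleGraph (Fin k × Fin n)) :=
  { G ∈ GFamily H n m ε | ¬ ContainsCopy H G }

/-- `m₂(H) = max { (e(H')-1)/(v(H')-2) : H' ⊆ H, v(H') ≥ 3 }`, where the maximum runs over
all subgraphs `H'` of `H` (given by a vertex set `S` of size at least `3` and a set of edges
of `H` inside `S`). -/
noncomputable def m2 {V : Type} [Fintype V] [DecidableEq V] (H : SimpleGraph V) : ℝ :=
  sSup { x : ℝ | ∃ (H' : SimpleGraph V) (S : Finset V),
    H' ≤ H ∧ (∀ e ∈ H'.edgeFinset, ∀ v ∈ e, v ∈ S) ∧ 3 ≤ S.card ∧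
    x = ((H'.edgeFinset.card : ℝ) - 1) / ((S.card : ℝ) - 2) }

/-- Every member `I` of the family `𝓘` has a fingerprint `S ⊆ I` of size at most `s`, and `S`
alone determines a good container for `I \ S`. -/
def HasContainers {V : Type} [DecidableEq V] (𝓘 : Finset V → Prop) (s : ℝ)
    (Good : Finset V → Prop) : Prop :=
  ∃ F : Finset V → Finset V, ∀ I, 𝓘 I → ∃ S ⊆ I, (S.card : ℝ) ≤ s ∧ I \ S ⊆ F S ∧ Good (F S)

theorem HasContainers.mono {V : Type} [DecidableEq V] {𝓘 𝓘' : Finset V → Prop} {s s' : ℝ}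
    {Good : Finset V → Prop} (h : HasContainers 𝓘 s Good) (hI : ∀ I, 𝓘' I → 𝓘 I)
    (hs : s ≤ s') : HasContainers 𝓘' s' Good := by
  obtain ⟨F, hF⟩ := h
  refine ⟨F, fun I hI' => ?_⟩
  obtain ⟨S, h1, h2, h3⟩ := hF I (hI I hI')
  exact ⟨S, h1, h2.trans hs, h3⟩

theorem HasContainers.greedy {V : Type} [Fintype V] [DecidableEq V] {𝓘 : Finset V → Prop}
    {𝓘' : V → Finset V → Prop} {s : ℝ} {Good : Finset V → Prop} (A : Finset V)
    (hbase : HasContainers (fun I => 𝓘 I ∧ Disjoint I A) (s + 1) Good)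
    (hstep : ∀ v ∈ A, HasContainers (𝓘' v) s Good)
    (hI : ∀ I, ∀ v ∈ A, v ∈ I → 𝓘 I → 𝓘' v (I.erase v)) :
    HasContainers 𝓘 (s + 1) Good := by
  obtain ⟨F₀, hF₀⟩ := hbase
  choose! F hF using hstep
  let _ : LinearOrder V := LinearOrder.lift' (Fintype.equivFin V) (Equiv.injective _)
  refine ⟨fun S => if h : (S ∩ A).Nonempty then F ((S ∩ A).min' h) (S.erase ((S ∩ A).min' h))
    else F₀ S, fun I hI' => ?_⟩
  by_cases h : (I ∩ A).Nonempty
  · set v := (I ∩ A).min' h with hv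
    have hvm : v ∈ I ∩ A := min'_mem _ _
    obtain ⟨hvI, hvA⟩ := mem_inter.1 hvm
    obtain ⟨S, hSI, hS, hc, hg⟩ := hF v hvA (I.erase v) (hI I v hvA hvI hI')
    have hvS : v ∉ S := fun h => (mem_erase.1 (hSI h)).1 rfl
    have hSI' : insert v S ⊆ I := by
      intro x hx
      rcases mem_insert.1 hx with rfl | hx
      · exact hvI
      · exact (mem_erase.1 (hSI hx)).2
    have hne : (insert v S ∩ A).Nonempty := ⟨v, mem_inter.2 ⟨mem_insert_self _ _, hvA⟩⟩
    have hmin : (insert v S ∩ A).min' hne = v := by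
      apply le_antisymm
      · exact min'_le _ _ (mem_inter.2 ⟨mem_insert_self _ _, hvA⟩)
      · exact min'_subset _ (inter_subset_inter_right hSI')
    refine ⟨insert v S, hSI', ?_, ?_⟩
    · rw [card_insert_of_notMem hvS]; push_cast; linarith
    · dsimp only
      rw [dif_pos hne, hmin, erase_insert hvS]
      refine ⟨fun x hx => hc ?_, hg⟩
      simp only [mem_sdiff, mem_insert, not_or, mem_erase] at hx ⊢
      tauto
  · obtain ⟨S, hSI, hS, hc⟩ := hF₀ I ⟨hI', by
      rw [disjoint_iff_inter_eq_empty]; exact not_nonempty_iff_eq_empty.1 h⟩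
    refine ⟨S, hSI, hS, ?_⟩
    dsimp only
    rw [dif_neg (fun h' : (S ∩ A).Nonempty => h (h'.mono (inter_subset_inter_right hSI)))]
    exact hc

/-- The weighted degree of `T` in the weighted hypergraph `w`. -/
noncomputable def wdeg {V : Type} [Fintype V] [DecidableEq V] (w : Finset V → ℝ)
    (T : Finset V) : ℝ :=
  ∑ e with T ⊆ e, w e

/-- `I` contains no edge of the weighted hypergraph `w`. -/
def Indep {V : Type} (w : Finset V → ℝ) (I : Finset V) : Prop :=
  ∀ e ⊆ I, w e = 0

/-- Add to `u` the link of `v` in `a`. -/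
def addLink {V : Type} [DecidableEq V] (u a : Finset V → ℝ) (v : V) (f : Finset V) : ℝ :=
  u f + if v ∈ f then 0 else a (insert v f)

section
variable {V : Type} [Fintype V] [DecidableEq V]

theorem wdeg_empty (w : Finset V → ℝ) : wdeg w ∅ = ∑ e, w e := by simp [wdeg]

theorem wdeg_nonneg {w : Finset V → ℝ} (hw : ∀ e, 0 ≤ w e) (T : Finset V) : 0 ≤ wdeg w T :=
  sum_nonneg fun e _ => hw e

theorem wdeg_mono {w w' : Finset V → ℝ} (hw : ∀ e, w e ≤ w' e) (T : Finset V) :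
    wdeg w T ≤ wdeg w' T :=
  sum_le_sum fun e _ => hw e

theorem wdeg_addLink_of_mem {u a : Finset V → ℝ} {v : V} {T : Finset V} (h : v ∈ T) :
    wdeg (addLink u a v) T = wdeg u T := by
  refine sum_congr rfl fun e he => ?_
  simp [addLink, (mem_filter.1 he).2 h]

theorem wdeg_addLink_of_notMem {u a : Finset V → ℝ} {v : V} {T : Finset V} (h : v ∉ T) :
    wdeg (addLink u a v) T = wdeg u T + wdeg a (insert v T) := by
  simp only [wdeg, addLink, sum_add_distrib]
  congr 1
  rw [← sum_filter_add_sum_filter_not _ (fun f => v ∈ f)]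
  rw [sum_eq_zero (fun e he => by simp [(mem_filter.1 he).2]), zero_add]
  refine sum_nbij' (fun f => insert v f) (fun e => e.erase v) ?_ ?_ ?_ ?_ ?_
  · intro f hf
    simp only [mem_filter, mem_univ, true_and] at hf ⊢
    exact insert_subset_insert _ hf.1
  · intro e he
    simp only [mem_filter, mem_univ, true_and] at he ⊢
    refine ⟨fun x hx => mem_erase.2 ⟨fun hxv => h (hxv ▸ hx), he (mem_insert_of_mem hx)⟩, by simp⟩
  · intro f hf
    exact erase_insert (mem_filter.1 hf).2
  · intro e he
    simp only [mem_filter, mem_univ, true_and] at he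
    exact insert_erase (he (mem_insert_self _ _))
  · intro f hf
    rw [if_neg (mem_filter.1 hf).2]

theorem sum_wdeg {w : Finset V → ℝ} {ℓ : ℕ} (hw : ∀ e, w e ≠ 0 → e.card = ℓ) :
    ∑ T, wdeg w T = 2 ^ ℓ * ∑ e, w e := by
  simp only [wdeg, sum_filter]
  rw [sum_comm, mul_sum]
  refine sum_congr rfl fun e _ => ?_
  rw [← sum_filter, sum_const, nsmul_eq_mul]
  by_cases h : w e = 0
  · simp [h]
  · have : (univ.filter fun T => T ⊆ e) = e.powerset := by ext; simp
    rw [this, card_powerset, hw e h]; simp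

theorem sum_wdeg_singleton {w : Finset V → ℝ} {ℓ : ℕ} {B : Finset V}
    (hw : ∀ e, w e ≠ 0 → e ⊆ B ∧ e.card = ℓ) :
    ∑ v ∈ B, wdeg w {v} = ℓ * ∑ e, w e := by
  simp only [wdeg, sum_filter]
  rw [sum_comm, mul_sum]
  refine sum_congr rfl fun e _ => ?_
  rw [← sum_filter, sum_const, nsmul_eq_mul]
  by_cases h : w e = 0
  · simp [h]
  · have : (B.filter fun v => {v} ⊆ e) = e := by
      ext x; simp only [mem_filter, singleton_subset_iff]
      exact ⟨fun h => h.2, fun hx => ⟨(hw e h).1 hx, hx⟩⟩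
    rw [this, (hw e h).2]

end

/-- The part of the weighted hypergraph `w` avoiding every nonempty set whose degree in `u` has
reached its saturation level. -/
noncomputable def available {V : Type} [Fintype V] [DecidableEq V] (w u : Finset V → ℝ)
    (D p : ℝ) (e : Finset V) : ℝ :=
  if ∃ T ⊆ e, T.Nonempty ∧ D * p ^ (T.card + 1) ≤ wdeg u T then 0 else w e

theorem addLink_nonneg {V : Type} [DecidableEq V] {u a : Finset V → ℝ} (hu : ∀ e, 0 ≤ u e)
    (ha : ∀ e, 0 ≤ a e) (v : V) (f : Finset V) : 0 ≤ addLink u a v f := by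
  unfold addLink; split_ifs
  · simpa using hu f
  · exact add_nonneg (hu f) (ha _)

theorem addLink_support {V : Type} [DecidableEq V] {u a : Finset V → ℝ} {B : Finset V} {ℓ : ℕ}
    (hu : ∀ e, u e ≠ 0 → e ⊆ B ∧ e.card = ℓ) (ha : ∀ e, a e ≠ 0 → e ⊆ B ∧ e.card = ℓ + 1)
    (v : V) (f : Finset V) (hf : addLink u a v f ≠ 0) : f ⊆ B ∧ f.card = ℓ := by
  by_cases h : u f = 0
  · by_cases hv : v ∈ f
    · simp [addLink, h, hv] at hf
    · simp only [addLink, h, hv, if_false, zero_add] at hf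
      obtain ⟨h1, h2⟩ := ha _ hf
      rw [card_insert_of_notMem hv] at h2
      exact ⟨(subset_insert _ _).trans h1, by omega⟩
  · exact hu f h

section
variable {V : Type} [Fintype V] [DecidableEq V] {w u : Finset V → ℝ} {D p K N : ℝ} {ℓ : ℕ}

theorem available_nonneg (hw : ∀ e, 0 ≤ w e) (e : Finset V) : 0 ≤ available w u D p e := by
  unfold available; split_ifs <;> simp [hw]

theorem available_le (hw : ∀ e, 0 ≤ w e) (e : Finset V) : available w u D p e ≤ w e := by
  unfold available; split_ifs <;> simp [hw]

theorem wdeg_addLink_available_le (hw : ∀ e, 0 ≤ w e)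
    (hdeg : ∀ T : Finset V, T.Nonempty → wdeg w T ≤ K * D * p ^ T.card)
    (hudeg : ∀ T : Finset V, T.Nonempty → wdeg u T ≤ (1 + K) * D * p ^ (T.card + 1))
    (v : V) (T : Finset V) (hT : T.Nonempty) :
    wdeg (addLink u (available w u D p) v) T ≤ (1 + K) * D * p ^ (T.card + 1) := by
  by_cases hv : v ∈ T
  · rw [wdeg_addLink_of_mem hv]; exact hudeg T hT
  rw [wdeg_addLink_of_notMem hv]
  by_cases hs : D * p ^ (T.card + 1) ≤ wdeg u T
  · have : wdeg (available w u D p) (insert v T) = 0 := by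
      refine sum_eq_zero fun e he => ?_
      rw [available, if_pos]
      exact ⟨T, (subset_insert _ _).trans (mem_filter.1 he).2, hT, hs⟩
    rw [this, add_zero]; exact hudeg T hT
  · have h1 : wdeg (available w u D p) (insert v T) ≤ K * D * p ^ (T.card + 1) := by
      have := (wdeg_mono (available_le (u := u) (D := D) (p := p) hw) (insert v T)).trans
        (hdeg (insert v T) (insert_nonempty _ _))
      rwa [card_insert_of_notMem hv] at this
    push Not at hs
    nlinarith

theorem sum_sub_available_le (hp : 0 < p) (hK : 0 ≤ K) (hw : ∀ e, 0 ≤ w e)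
    (hu : ∀ e, 0 ≤ u e) (hucard : ∀ e, u e ≠ 0 → e.card = ℓ)
    (hdeg : ∀ T : Finset V, T.Nonempty → wdeg w T ≤ K * D * p ^ T.card) :
    p * ∑ e, (w e - available w u D p e) ≤ K * 2 ^ ℓ * ∑ e, u e := by
  have h1 : ∑ e, (w e - available w u D p e) ≤
      ∑ T with T.Nonempty ∧ D * p ^ (T.card + 1) ≤ wdeg u T, wdeg w T := by
    have h2 : ∀ T, wdeg w T = ∑ e, if T ⊆ e then w e else 0 := fun T => sum_filter _ _
    simp only [h2]
    rw [sum_comm]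
    refine sum_le_sum fun e _ => ?_
    have h3 : ∀ T, 0 ≤ if T ⊆ e then w e else 0 := fun T => by split_ifs <;> simp [hw]
    rw [available]
    split_ifs with h
    · obtain ⟨T, h4, h5, h6⟩ := h
      rw [sub_zero]
      calc w e = if T ⊆ e then w e else 0 := (if_pos h4).symm
        _ ≤ _ := single_le_sum (f := fun T => if T ⊆ e then w e else 0) (fun T _ => h3 T)
          (mem_filter.2 ⟨mem_univ T, h5, h6⟩)
    · rw [sub_self]; exact sum_nonneg fun T _ => h3 T
  calc p * ∑ e, (w e - available w u D p e)
      ≤ p * ∑ T with T.Nonempty ∧ D * p ^ (T.card + 1) ≤ wdeg u T, wdeg w T :=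
        mul_le_mul_of_nonneg_left h1 hp.le
    _ = ∑ T with T.Nonempty ∧ D * p ^ (T.card + 1) ≤ wdeg u T, p * wdeg w T := mul_sum _ _ _
    _ ≤ ∑ T with T.Nonempty ∧ D * p ^ (T.card + 1) ≤ wdeg u T, K * wdeg u T := by
        refine sum_le_sum fun T hT => ?_
        obtain ⟨h2, h3⟩ := (mem_filter.1 hT).2
        calc p * wdeg w T ≤ p * (K * D * p ^ T.card) := mul_le_mul_of_nonneg_left (hdeg T h2) hp.le
          _ = K * (D * p ^ (T.card + 1)) := by ring
          _ ≤ _ := mul_le_mul_of_nonneg_left h3 hK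
    _ ≤ ∑ T, K * wdeg u T := sum_le_sum_of_subset_of_nonneg (filter_subset _ _)
        fun T _ _ => mul_nonneg hK (wdeg_nonneg hu T)
    _ = K * 2 ^ ℓ * ∑ e, u e := by rw [← mul_sum, sum_wdeg hucard, mul_assoc]

theorem indep_addLink {I : Finset V} {v : V} (hvI : v ∈ I) (hI : Indep w I) (hIu : Indep u I) :
    Indep (addLink u (available w u D p) v) (I.erase v) := by
  intro f hf
  have hf' : f ⊆ I := hf.trans (erase_subset _ _)
  have : available w u D p (insert v f) = 0 := by
    unfold available
    split_ifs
    · rfl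
    · exact hI _ (insert_subset hvI hf')
  simp [addLink, hIu f hf', this]

/-- Many vertices have large degree in the available hypergraph. -/
theorem card_large_wdeg_available {B : Finset V} (hp : 0 < p) (hD : 0 < D) (hK : 0 < K)
    (hN : 0 < N)
    (hBN : (B.card : ℝ) ≤ N) (hw : ∀ e, 0 ≤ w e) (hu : ∀ e, 0 ≤ u e)
    (hsupp : ∀ e, w e ≠ 0 → e ⊆ B ∧ e.card = ℓ + 1)
    (hucard : ∀ e, u e ≠ 0 → e.card = ℓ)
    (hdeg : ∀ T : Finset V, T.Nonempty → wdeg w T ≤ K * D * p ^ T.card)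
    (htot : D * p * N ≤ ∑ e, w e)
    (hutot : ∑ e, u e ≤ 1 / (K * 2 ^ (ℓ + 1)) * D * p * p * N) :
    N / (4 * K) ≤ ((B.filter fun v => D * p / 4 ≤ wdeg (available w u D p) {v}).card : ℝ) := by
  set a := available w u D p
  have hlost := sum_sub_available_le hp hK.le hw hu hucard hdeg
  have h1 : D * p * N / 2 ≤ ∑ e, a e := by
    rw [sum_sub_distrib] at hlost
    have : K * 2 ^ ℓ * ∑ e, u e ≤ p * (D * p * N / 2) := by
      calc _ ≤ K * 2 ^ ℓ * (1 / (K * 2 ^ (ℓ + 1)) * D * p * p * N) := by gcongr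
        _ = _ := by field_simp; ring
    have := le_of_mul_le_mul_left (hlost.trans this) hp
    linarith
  have hasupp : ∀ e, a e ≠ 0 → e ⊆ B ∧ e.card = ℓ + 1 := by
    intro e he
    refine hsupp e fun h => he ?_
    exact le_antisymm ((available_le hw e).trans h.le) (available_nonneg hw e)
  have h2 := sum_wdeg_singleton hasupp
  have h3 : ∑ e, a e ≤ ∑ v ∈ B, wdeg a {v} := by
    rw [h2]; push_cast
    have : 0 ≤ ∑ e, a e := sum_nonneg fun e _ => available_nonneg hw e
    nlinarith [Nat.cast_nonneg (α := ℝ) ℓ]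
  have h4 : ∑ v ∈ B, wdeg a {v} ≤
      ((B.filter fun v => D * p / 4 ≤ wdeg a {v}).card : ℝ) * (K * D * p) + N * (D * p / 4) := by
    rw [← sum_filter_add_sum_filter_not B (fun v => D * p / 4 ≤ wdeg a {v})]
    gcongr
    · rw [← nsmul_eq_mul]
      refine sum_le_card_nsmul _ _ _ fun v _ => ?_
      have := (wdeg_mono (available_le (u := u) (D := D) (p := p) hw) {v}).trans
        (hdeg {v} (singleton_nonempty v))
      simpa using this
    · calc _ ≤ (B.filter fun v => ¬ D * p / 4 ≤ wdeg a {v}).card • (D * p / 4) :=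
          sum_le_card_nsmul _ _ _ fun v hv => (not_le.1 (mem_filter.1 hv).2).le
        _ ≤ _ := by
          rw [nsmul_eq_mul]
          gcongr
          exact le_trans (by exact_mod_cast card_filter_le _ _) hBN
  rw [div_le_iff₀ (by positivity)]
  have hDp : 0 < D * p := by positivity
  refine le_of_mul_le_mul_left ?_ hDp
  linarith

end

/-- A weighted `ℓ`-uniform hypergraph with well-spread degrees has a fingerprint step: either the
family restricts to a set missing a proportion `δ` of the vertices, for which containers are
given, or it has them anyway. -/
theorem hypergraph_container (ℓ : ℕ) : ∀ K : ℝ, 1 ≤ K → ∃ δ : ℝ, 0 < δ ∧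
    ∀ {V : Type} [Fintype V] [DecidableEq V] (B : Finset V) (w : Finset V → ℝ) (N p D s : ℝ)
      (𝓙 Good : Finset V → Prop), 0 < N → (B.card : ℝ) ≤ N → 0 < p → 0 < D →
      (∀ e, 0 ≤ w e) → (∀ e, w e ≠ 0 → e ⊆ B ∧ e.card = ℓ) → D * p * N ≤ ∑ e, w e →
      (∀ T : Finset V, T.Nonempty → wdeg w T ≤ K * D * p ^ T.card) →
      (∀ I J, J ⊆ I → 𝓙 I → 𝓙 J) →
      (∀ B' : Finset V, δ * N ≤ (B \ B').card → HasContainers (fun I => 𝓙 I ∧ I ⊆ B') s Good) →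
      HasContainers (fun I => 𝓙 I ∧ Indep w I) (ℓ * (4 * p * N + 1) + s) Good := by
  induction ℓ with
  | zero =>
    intro K _
    refine ⟨1, one_pos, ?_⟩
    intro V _ _ B w N p D s 𝓙 Good hN _ hp hD _ hsupp htot _ _ _
    refine ⟨id, fun I hI => ?_⟩
    have : ∑ e, w e = 0 := by
      refine sum_eq_zero fun e _ => ?_
      by_contra h
      rw [card_eq_zero.1 (hsupp e h).2] at h
      exact h (hI.2 ∅ (empty_subset _))
    have : 0 < D * p * N := by positivity
    linarith
  | succ ℓ ih =>
    intro K hK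
    have hK0 : 0 < K := by linarith
    set c : ℝ := 1 / (K * 2 ^ (ℓ + 1)) with hc
    have hc0 : 0 < c := by positivity
    have hc1 : c ≤ 1 := by
      rw [hc, div_le_one (by positivity)]
      have : (1 : ℝ) ≤ 2 ^ (ℓ + 1) := one_le_pow₀ (by norm_num)
      nlinarith
    obtain ⟨δ, hδ, hmain⟩ := ih ((1 + K) / c) (by rw [le_div_iff₀ hc0]; linarith)
    refine ⟨min δ (1 / (4 * K)), by positivity, ?_⟩
    intro V _ _ B w N p D s 𝓙 Good hN hBN hp hD hw hsupp htot hdeg h𝓙 hcont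
    have key : ∀ (t : ℕ) (u : Finset V → ℝ), (∀ e, 0 ≤ u e) →
        (∀ e, u e ≠ 0 → e ⊆ B ∧ e.card = ℓ) →
        (∀ T : Finset V, T.Nonempty → wdeg u T ≤ (1 + K) * D * p ^ (T.card + 1)) →
        c * D * p * p * N - t * (D * p / 4) ≤ ∑ e, u e →
        HasContainers (fun I => 𝓙 I ∧ Indep w I ∧ Indep u I)
          (ℓ * (4 * p * N + 1) + s + t) Good := by
      intro t
      induction t with
      | zero =>
        intro u hu husupp hudeg hutot
        refine HasContainers.mono (hmain B u N p (c * D * p) s 𝓙 Good hN hBN hp (by positivity) hu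
          husupp ?_ ?_ h𝓙 ?_) (fun I hI => ⟨hI.1, hI.2.2⟩) (by simp)
        · simpa using hutot
        · intro T hT
          refine (hudeg T hT).trans_eq ?_
          field_simp
          ring
        · intro B' hB'
          exact hcont B' (le_trans (by gcongr; exact min_le_left _ _) hB')
      | succ t iht =>
        intro u hu husupp hudeg hutot
        by_cases hbig : c * D * p * p * N ≤ ∑ e, u e
        · refine (iht u hu husupp hudeg ?_).mono (fun I hI => hI) (by push_cast; linarith)
          have : 0 ≤ (t : ℝ) * (D * p / 4) := by positivity
          linarith
        · set a := available w u D p with ha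
          have hgreedy := HasContainers.greedy (V := V) (𝓘 := fun I => 𝓙 I ∧ Indep w I ∧ Indep u I)
            (𝓘' := fun v I => 𝓙 I ∧ Indep w I ∧ Indep (addLink u a v) I)
            (s := ℓ * (4 * p * N + 1) + s + t) (Good := Good)
            (univ.filter fun v => D * p / 4 ≤ wdeg a {v}) ?_ ?_ ?_
          · exact hgreedy.mono (fun _ h => h) (by push_cast; linarith)
          · have := hcont (univ \ univ.filter fun v => D * p / 4 ≤ wdeg a {v}) ?_
            · refine this.mono (fun I hI => ⟨hI.1.1, ?_⟩) ?_
              · intro x hx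
                exact mem_sdiff.2 ⟨mem_univ _, fun h => disjoint_left.1 hI.2 hx h⟩
              · have : 0 ≤ (ℓ : ℝ) * (4 * p * N + 1) := by positivity
                have : (0 : ℝ) ≤ t := by positivity
                linarith
            · have h1 := card_large_wdeg_available hp hD hK0 hN hBN hw hu hsupp
                (fun e he => (husupp e he).2) hdeg htot (not_le.1 hbig).le
              have h2 : B \ (univ \ univ.filter fun v => D * p / 4 ≤ wdeg a {v}) =
                  B.filter fun v => D * p / 4 ≤ wdeg a {v} := by
                ext x; simp
              rw [h2]
              refine le_trans ?_ h1
              rw [show N / (4 * K) = 1 / (4 * K) * N by ring]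
              exact mul_le_mul_of_nonneg_right (min_le_right _ _) hN.le
          · intro v hv
            have hv' := (mem_filter.1 hv).2
            refine iht _ (addLink_nonneg hu (available_nonneg hw) v) (addLink_support husupp ?_ v)
              (wdeg_addLink_available_le hw hdeg hudeg v) ?_
            · intro e he
              refine hsupp e fun h => he ?_
              exact le_antisymm ((available_le hw e).trans h.le) (available_nonneg hw e)
            · rw [← wdeg_empty, wdeg_addLink_of_notMem (notMem_empty v), wdeg_empty]
              push_cast at hutot
              rw [insert_empty_eq]
              linarith
          · rintro I v - hvI ⟨h1, h2, h3⟩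
            exact ⟨h𝓙 _ _ (erase_subset _ _) h1,
              fun e he => h2 e (he.trans (erase_subset _ _)), indep_addLink hvI h2 h3⟩
    refine (key ⌈4 * p * N⌉₊ 0 (fun _ => le_rfl) (by simp) ?_ ?_).mono
      (fun I hI => ⟨hI.1, hI.2, fun _ _ => rfl⟩) ?_
    · intro T _
      simp only [wdeg, Pi.zero_apply, sum_const_zero]
      positivity
    · have : 4 * p * N ≤ ⌈4 * p * N⌉₊ := Nat.le_ceil _
      simp only [Pi.zero_apply, sum_const_zero]
      have h1 : 4 * p * N * (D * p / 4) ≤ ⌈4 * p * N⌉₊ * (D * p / 4) := by gcongr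
      have h2 : c * (D * p * p * N) ≤ 1 * (D * p * p * N) := by gcongr
      linarith
    · have := (Nat.ceil_lt_add_one (show 0 ≤ 4 * p * N by positivity)).le
      push_cast
      linarith

/-- Either there are many canonical copies of the pattern `R`, or some pair of large sets spans
very few edges. -/
theorem exists_many_copies_or_sparse_pair (d : ℝ → ℝ) (hd : ∀ α, 0 < α → 0 < d α) (k : ℕ) :
    ∀ α : ℝ, 0 < α → ∃ ξ α₀ : ℝ, 0 < ξ ∧ 0 < α₀ ∧
      ∀ (R : Fin k → Fin k → Prop) (n : ℕ) (E : Fin k → Fin k → Fin n → Fin n → Prop)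
        (U : Fin k → Finset (Fin n)), (∀ i, α * n ≤ (U i).card) →
        ξ * n ^ k ≤ ((univ.filter fun x : Fin k → Fin n => (∀ i, x i ∈ U i) ∧
            ∀ i j, i < j → R i j → E i j (x i) (x j)).card : ℝ) ∨
        ∃ i j, i < j ∧ R i j ∧ ∃ α', α₀ ≤ α' ∧ ∃ A A' : Finset (Fin n),
          α' * n ≤ A.card ∧ α' * n ≤ A'.card ∧
          (((A ×ˢ A').filter fun z => E i j z.1 z.2).card : ℝ) ≤ d α' * (A.card * A'.card) := by
  induction k with
  | zero =>
    intro α _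
    refine ⟨1, 1, one_pos, one_pos, fun R n E U _ => Or.inl ?_⟩
    simp
  | succ k ih =>
    intro α hα
    set α₁ := α / (2 * (k + 1)) with hα₁
    have hα₁0 : 0 < α₁ := by positivity
    have hd1 := hd α₁ hα₁0
    set τ := min 1 (d α₁) with hτ
    have hτ0 : 0 < τ := lt_min one_pos hd1
    obtain ⟨ξ, α₀, hξ, hα₀, hmain⟩ := ih (τ * α) (by positivity)
    refine ⟨α / 2 * ξ, min α₁ α₀, by positivity, by positivity, ?_⟩
    intro R n E U hU
    set X : Fin k → Finset (Fin n) := fun j => if R 0 j.succ then (U 0).filter fun a =>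
      (((U j.succ).filter fun b => E 0 j.succ a b).card : ℝ) ≤ d α₁ * (U j.succ).card else ∅
      with hX
    by_cases hbad : ∃ j, R 0 j.succ ∧ α₁ * n ≤ (X j).card
    · obtain ⟨j, hj, hXj⟩ := hbad
      refine Or.inr ⟨0, j.succ, Fin.succ_pos j, hj, α₁, min_le_left _ _, X j, U j.succ, hXj, ?_, ?_⟩
      · refine le_trans ?_ (hU j.succ)
        gcongr
        rw [hα₁]
        apply div_le_self hα.le
        have : (0 : ℝ) ≤ k := by positivity
        linarith
      · have h1 : (((X j ×ˢ U j.succ).filter fun z => E 0 j.succ z.1 z.2).card : ℝ) =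
            ∑ a ∈ X j, (((U j.succ).filter fun b => E 0 j.succ a b).card : ℝ) := by
          simp only [card_filter, sum_product]; push_cast; rfl
        rw [h1]
        calc _ ≤ (X j).card • (d α₁ * (U j.succ).card) := by
              refine sum_le_card_nsmul _ _ _ fun a ha => ?_
              simp only [hX, if_pos hj] at ha
              exact (mem_filter.1 ha).2
          _ = _ := by rw [nsmul_eq_mul]; ring
    · push Not at hbad
      have hXcard : ∀ j, ((X j).card : ℝ) ≤ α₁ * n := by
        intro j
        by_cases hj : R 0 j.succ
        · exact (hbad j hj).le
        · simp only [hX, if_neg hj, card_empty, Nat.cast_zero]; positivity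
      set Y := U 0 \ univ.biUnion X with hY
      have hYcard : α / 2 * n ≤ (Y.card : ℝ) := by
        have h1 : ((univ.biUnion X).card : ℝ) ≤ k * (α₁ * n) := by
          calc ((univ.biUnion X).card : ℝ) ≤ ∑ j, ((X j).card : ℝ) := by
                exact_mod_cast card_biUnion_le
            _ ≤ ∑ _j : Fin k, α₁ * n := sum_le_sum fun j _ => hXcard j
            _ = _ := by simp
        have h2 : ((U 0).card : ℝ) ≤ Y.card + (univ.biUnion X).card := by
          exact_mod_cast card_le_card_sdiff_add_card
        have h3 : k * (α₁ * n) ≤ α / 2 * n := by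
          rw [← mul_assoc]
          gcongr
          rw [hα₁, mul_div_assoc', div_le_div_iff₀ (by positivity) (by positivity)]
          nlinarith
        have := hU 0
        linarith
      set W : Fin n → Fin k → Finset (Fin n) := fun a j =>
        if R 0 j.succ then (U j.succ).filter fun b => E 0 j.succ a b else U j.succ with hW
      have hWcard : ∀ a ∈ Y, ∀ j, τ * α * n ≤ ((W a j).card : ℝ) := by
        intro a ha j
        have hUj := hU j.succ
        have hn : (0 : ℝ) ≤ α * n := by positivity
        by_cases hj : R 0 j.succ
        · simp only [hW, if_pos hj]
          obtain ⟨ha0, haX⟩ := mem_sdiff.1 ha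
          have : a ∉ X j := fun h => haX (mem_biUnion.2 ⟨j, mem_univ _, h⟩)
          simp only [hX, if_pos hj, mem_filter, not_and, not_le] at this
          refine le_trans ?_ (this ha0).le
          rw [mul_assoc]
          exact mul_le_mul (min_le_right _ _) hUj hn hd1.le
        · simp only [hW, if_neg hj]
          refine le_trans ?_ hUj
          rw [mul_assoc]
          exact mul_le_of_le_one_left hn (min_le_left _ _)
      have hIH := fun a (ha : a ∈ Y) => hmain (fun i j => R i.succ j.succ) n
        (fun i j => E i.succ j.succ) (W a) (hWcard a ha)
      by_cases hsp : ∃ i j : Fin k, i < j ∧ R i.succ j.succ ∧ ∃ α', α₀ ≤ α' ∧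
          ∃ A A' : Finset (Fin n), α' * n ≤ A.card ∧ α' * n ≤ A'.card ∧
          (((A ×ˢ A').filter fun z => E i.succ j.succ z.1 z.2).card : ℝ) ≤
            d α' * (A.card * A'.card)
      · obtain ⟨i, j, hij, hR, α', hα', h⟩ := hsp
        exact Or.inr ⟨i.succ, j.succ, Fin.succ_lt_succ_iff.2 hij, hR, α',
          (min_le_right _ _).trans hα', h⟩
      · left
        have hcopies := fun a ha => (hIH a ha).resolve_right hsp
        set Z : Fin n → Finset (Fin k → Fin n) := fun a => univ.filter fun x =>
          (∀ i, x i ∈ W a i) ∧ ∀ i j, i < j → R i.succ j.succ → E i.succ j.succ (x i) (x j) with hZ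
        have hsum : ∑ a ∈ Y, (Z a).card ≤ (univ.filter fun x : Fin (k + 1) → Fin n =>
            (∀ i, x i ∈ U i) ∧ ∀ i j, i < j → R i j → E i j (x i) (x j)).card := by
          rw [← card_sigma]
          refine card_le_card_of_injOn (fun z => Fin.cons z.1 z.2) ?_ ?_
          · rintro ⟨a, x⟩ hax
            have hax' := mem_sigma.1 (mem_coe.1 hax)
            obtain ⟨ha, hx⟩ := hax'
            simp only [hZ, mem_filter, mem_univ, true_and] at hx ha
            obtain ⟨hx1, hx2⟩ := hx
            have hWU : ∀ j, x j ∈ U j.succ ∧ (R 0 j.succ → E 0 j.succ a (x j)) := by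
              intro j
              have := hx1 j
              simp only [hW] at this
              split_ifs at this with hj
              · exact ⟨(mem_filter.1 this).1, fun _ => (mem_filter.1 this).2⟩
              · exact ⟨this, fun h => absurd h hj⟩
            simp only [coe_filter, mem_univ, true_and, Set.mem_ofPred_eq]
            refine ⟨fun i => ?_, fun i j hij hR => ?_⟩
            · refine Fin.cases ?_ (fun i => ?_) i
              · exact (mem_sdiff.1 ha).1
              · exact (hWU i).1
            · revert hij hR
              refine Fin.cases ?_ (fun j => ?_) j
              · intro h; exact absurd h (Fin.not_lt_zero i)
              · refine Fin.cases ?_ (fun i => ?_) i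
                · intro _ hR; exact (hWU j).2 hR
                · intro hij hR; exact hx2 i j (Fin.succ_lt_succ_iff.1 hij) hR
          · rintro ⟨a, x⟩ _ ⟨b, y⟩ _ h
            obtain ⟨h1, h2⟩ := Fin.cons_inj.1 h
            subst h1 h2
            rfl
        calc α / 2 * ξ * (n : ℝ) ^ (k + 1) = (α / 2 * n) * (ξ * n ^ k) := by ring
          _ ≤ Y.card * (ξ * n ^ k) := by gcongr
          _ = ∑ _a ∈ Y, ξ * (n : ℝ) ^ k := by rw [sum_const, nsmul_eq_mul]
          _ ≤ ∑ a ∈ Y, ((Z a).card : ℝ) := sum_le_sum fun a ha => hcopies a ha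
          _ ≤ _ := by exact_mod_cast hsum

theorem choose_sub_le_div_pow_mul_choose (r : ℕ) : ∀ M m : ℕ, r ≤ m → m ≤ M →
    (((M - r).choose (m - r) : ℕ) : ℝ) ≤ ((m : ℝ) / M) ^ r * (M.choose m : ℝ) := by
  induction r with
  | zero => intro M m _ _; simp
  | succ r ih =>
    intro M m hr hm
    obtain ⟨m, rfl⟩ : ∃ m', m = m' + 1 := ⟨m - 1, by omega⟩
    obtain ⟨M, rfl⟩ : ∃ M', M = M' + 1 := ⟨M - 1, by omega⟩
    have hm' : m ≤ M := by omega
    rw [Nat.add_sub_add_right, Nat.add_sub_add_right]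
    refine (ih M m (by omega) hm').trans ?_
    have h1 : (M.choose m : ℝ) = ((m + 1 : ℕ) : ℝ) / ((M + 1 : ℕ) : ℝ) * ((M + 1).choose (m + 1)) := by
      have := Nat.add_one_mul_choose_eq M m
      have h2 : ((M + 1 : ℕ) : ℝ) * M.choose m = (M + 1).choose (m + 1) * ((m + 1 : ℕ) : ℝ) := by
        exact_mod_cast this
      have h3 : ((M + 1 : ℕ) : ℝ) ≠ 0 := by positivity
      field_simp
      linarith
    rw [h1, pow_succ, mul_assoc]
    gcongr ?_ ^ r * _
    rcases Nat.eq_zero_or_pos M with rfl | hM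
    · simp; positivity
    · rw [div_le_div_iff₀ (by exact_mod_cast hM) (by positivity)]
      have : (m : ℝ) ≤ M := by exact_mod_cast hm'
      push_cast
      nlinarith

theorem card_powersetCard_superset_le {V : Type} [DecidableEq V] (P R : Finset V) (M m : ℕ)
    (hR : R ⊆ P) (hP : P.card ≤ M) (hm : m ≤ M) :
    (((powersetCard m P).filter (R ⊆ ·)).card : ℝ) ≤
      ((m : ℝ) / M) ^ R.card * (M.choose m : ℝ) := by
  by_cases hr : R.card ≤ m
  · refine le_trans ?_ (choose_sub_le_div_pow_mul_choose R.card M m hr hm)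
    have h1 : ((powersetCard m P).filter (R ⊆ ·)).card ≤
        (powersetCard (m - R.card) (P \ R)).card := by
      refine card_le_card_of_injOn (fun X => X \ R) ?_ ?_
      · intro X hX
        obtain ⟨hX, hRX⟩ := mem_filter.1 (mem_coe.1 hX)
        obtain ⟨hXP, hXm⟩ := mem_powersetCard.1 hX
        refine mem_coe.2 (mem_powersetCard.2 ⟨sdiff_subset_sdiff hXP le_rfl, ?_⟩)
        rw [card_sdiff_of_subset hRX, hXm]
      · intro X hX Y hY hXY
        have h1 := (mem_filter.1 (mem_coe.1 hX)).2
        have h2 := (mem_filter.1 (mem_coe.1 hY)).2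
        rw [← sdiff_union_of_subset h1, ← sdiff_union_of_subset h2]
        exact congrArg (· ∪ R) hXY
    rw [card_powersetCard, card_sdiff_of_subset hR] at h1
    exact_mod_cast h1.trans (Nat.choose_le_choose _ (Nat.sub_le_sub_right hP _))
  · rw [filter_eq_empty_iff.2]
    · simp only [card_empty, Nat.cast_zero]; positivity
    · intro X hX hRX
      exact hr ((card_le_card hRX).trans_eq (mem_powersetCard.1 hX).2)

/-- The sets with exactly `m` elements in each fibre of `π` over `E`, and no other elements. -/
noncomputable def transversalFamily {V ι : Type} [Fintype V] [DecidableEq V] [DecidableEq ι]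
    (π : V → ι) (E : Finset ι) (m : ℕ) : Finset (Finset V) :=
  univ.filter fun I => (∀ v ∈ I, π v ∈ E) ∧ ∀ e ∈ E, (I.filter fun v => π v = e).card = m

theorem card_transversalFamily_superset_le {V ι : Type} [Fintype V] [DecidableEq V]
    [DecidableEq ι] (π : V → ι) (E : Finset ι) (M m : ℕ)
    (hM : ∀ e ∈ E, (univ.filter fun v => π v = e).card ≤ M) (hm : m ≤ M) (R : Finset V) :
    (((transversalFamily π E m).filter (R ⊆ ·)).card : ℝ) ≤
      ((m : ℝ) / M) ^ R.card * (M.choose m : ℝ) ^ E.card := by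
  by_cases hR : ∀ v ∈ R, π v ∈ E
  · have h1 : ((transversalFamily π E m).filter (R ⊆ ·)).card ≤
        (E.pi fun e => (powersetCard m (univ.filter fun v => π v = e)).filter
          ((R.filter fun v => π v = e) ⊆ ·)).card := by
      refine card_le_card_of_injOn (fun I e _ => I.filter fun v => π v = e) ?_ ?_
      · intro I hI
        simp only [transversalFamily, coe_filter, mem_filter, mem_univ, true_and,
          Set.mem_ofPred_eq] at hI
        obtain ⟨⟨-, h2⟩, h3⟩ := hI
        refine mem_coe.2 (mem_pi.2 fun e he => mem_filter.2 ⟨mem_powersetCard.2 ⟨?_, h2 e he⟩, ?_⟩)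
        · exact filter_subset_filter _ (subset_univ _)
        · exact filter_subset_filter _ h3
      · intro I hI J hJ hIJ
        simp only [transversalFamily, coe_filter, mem_filter, mem_univ, true_and,
          Set.mem_ofPred_eq] at hI hJ
        have h2 : ∀ v, π v ∈ E → (v ∈ I ↔ v ∈ J) := by
          intro v hv
          have h3 := congrFun (congrFun hIJ (π v)) hv
          have h4 := Finset.ext_iff.1 h3 v
          simpa using h4
        ext v
        by_cases hv : π v ∈ E
        · exact h2 v hv
        · exact ⟨fun h => absurd (hI.1.1 v h) hv, fun h => absurd (hJ.1.1 v h) hv⟩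
    rw [card_pi] at h1
    calc _ ≤ ((∏ e ∈ E, ((powersetCard m (univ.filter fun v => π v = e)).filter
          ((R.filter fun v => π v = e) ⊆ ·)).card : ℕ) : ℝ) := by exact_mod_cast h1
      _ ≤ ∏ e ∈ E, (((m : ℝ) / M) ^ (R.filter fun v => π v = e).card * (M.choose m : ℝ)) := by
        push_cast
        refine prod_le_prod (fun _ _ => by positivity) fun e he => ?_
        exact card_powersetCard_superset_le _ _ M m (filter_subset_filter _ (subset_univ _))
          (hM e he) hm
      _ = _ := by
        rw [prod_mul_distrib, prod_const, prod_pow_eq_pow_sum,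
          card_eq_sum_card_fiberwise (f := π) (s := R) (t := E) hR]
  · rw [filter_eq_empty_iff.2]
    · simp only [card_empty, Nat.cast_zero]; positivity
    · intro I hI hRI
      exact hR fun v hv => (mem_filter.1 hI).2.1 v (hRI hv)

theorem choose_mul_pow_le (z q : ℕ) (x : ℝ) (hx : 0 ≤ x) (y : ℝ)
    (h : Real.exp 1 * z * x ≤ y * q) : (z.choose q : ℝ) * x ^ q ≤ y ^ q := by
  rcases Nat.eq_zero_or_pos q with rfl | hq
  · simp
  have hq' : (0 : ℝ) < q := by exact_mod_cast hq
  have h1 : (q : ℝ) ^ q / q.factorial ≤ Real.exp 1 ^ q := by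
    rw [← Real.exp_nat_mul, mul_one]
    exact Real.pow_div_factorial_le_exp _ hq'.le _
  have h2 : (z.choose q : ℝ) ≤ (z : ℝ) ^ q / q.factorial := Nat.choose_le_pow_div q z
  have h3 : (0 : ℝ) < (q : ℝ) ^ q := by positivity
  have hf : (0 : ℝ) < q.factorial := by positivity
  calc (z.choose q : ℝ) * x ^ q ≤ (z : ℝ) ^ q / q.factorial * x ^ q := by gcongr
    _ = (z * x / q) ^ q * ((q : ℝ) ^ q / q.factorial) := by
      rw [div_pow, mul_pow]; field_simp
    _ ≤ (z * x / q) ^ q * Real.exp 1 ^ q := by gcongr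
    _ = (Real.exp 1 * z * x / q) ^ q := by rw [← mul_pow]; congr 1; ring
    _ ≤ y ^ q := by
      have : Real.exp 1 * z * x / q ≤ y := by rwa [div_le_iff₀ hq']
      gcongr

section
variable {k : ℕ} (H : SimpleGraph (Fin k))

theorem bddAbove_m2 : BddAbove { x : ℝ | ∃ (H' : SimpleGraph (Fin k)) (S : Finset (Fin k)),
    H' ≤ H ∧ (∀ e ∈ H'.edgeFinset, ∀ v ∈ e, v ∈ S) ∧ 3 ≤ S.card ∧
    x = ((H'.edgeFinset.card : ℝ) - 1) / ((S.card : ℝ) - 2) } := by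
  apply Set.Finite.bddAbove
  apply (Set.finite_range fun z : SimpleGraph (Fin k) × Finset (Fin k) =>
    ((z.1.edgeFinset.card : ℝ) - 1) / ((z.2.card : ℝ) - 2)).subset
  rintro x ⟨H', S, -, -, -, rfl⟩
  exact ⟨(H', S), rfl⟩

/-- The vertices covered by a set of edges. -/
def coveredVertices (T : Finset (Sym2 (Fin k))) : Finset (Fin k) :=
  T.biUnion fun e => e.toFinset

theorem mem_coveredVertices {T : Finset (Sym2 (Fin k))} {v : Fin k} :
    v ∈ coveredVertices T ↔ ∃ e ∈ T, v ∈ e := by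
  simp [coveredVertices]

variable {H}

theorem le_m2 {T : Finset (Sym2 (Fin k))} (hT : T ⊆ H.edgeFinset)
    (hS : 3 ≤ (coveredVertices T).card) :
    ((T.card : ℝ) - 1) / ((coveredVertices T).card - 2) ≤ m2 H := by
  have hedge : ∀ inst : Fintype (SimpleGraph.fromEdgeSet (T : Set (Sym2 (Fin k)))).edgeSet,
      @SimpleGraph.edgeFinset _ _ inst = T := by
    intro inst
    ext e
    rw [SimpleGraph.mem_edgeFinset, SimpleGraph.edgeSet_fromEdgeSet]
    simp only [Set.mem_sdiff, mem_coe, Sym2.mem_diagSet, and_iff_left_iff_imp]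
    intro he
    exact SimpleGraph.not_isDiag_of_mem_edgeSet H (SimpleGraph.mem_edgeFinset.1 (hT he))
  refine le_csSup (bddAbove_m2 H)
    ⟨SimpleGraph.fromEdgeSet (T : Set (Sym2 (Fin k))), coveredVertices T, ?_, ?_, hS, ?_⟩
  · rw [← SimpleGraph.edgeFinset_subset_edgeFinset, hedge]; exact hT
  · intro e he v hv
    rw [hedge] at he
    exact mem_coveredVertices.2 ⟨e, he, hv⟩
  · rw [hedge]

theorem two_le_card_coveredVertices {T : Finset (Sym2 (Fin k))} (hT : T ⊆ H.edgeFinset)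
    (hne : T.Nonempty) : 2 ≤ (coveredVertices T).card := by
  obtain ⟨e, he⟩ := hne
  have hd := SimpleGraph.not_isDiag_of_mem_edgeSet H (SimpleGraph.mem_edgeFinset.1 (hT he))
  rw [← Sym2.card_toFinset_of_not_isDiag e hd]
  exact card_le_card (subset_biUnion_of_mem (fun e : Sym2 (Fin k) => e.toFinset) he)

theorem three_le_card_coveredVertices {T : Finset (Sym2 (Fin k))} (hT : T ⊆ H.edgeFinset)
    (h2 : 2 ≤ T.card) : 3 ≤ (coveredVertices T).card := by
  obtain ⟨e, he, f, hf, hef⟩ := one_lt_card.1 (show 1 < T.card by omega)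
  by_contra hlt
  have hcard : ∀ e ∈ T, e.toFinset = coveredVertices T := by
    intro e he
    have hd := SimpleGraph.not_isDiag_of_mem_edgeSet H (SimpleGraph.mem_edgeFinset.1 (hT he))
    refine eq_of_subset_of_card_le (subset_biUnion_of_mem (fun e : Sym2 (Fin k) => e.toFinset) he) ?_
    rw [Sym2.card_toFinset_of_not_isDiag e hd]; omega
  refine hef (Sym2.ext fun x => ?_)
  rw [← Sym2.mem_toFinset, ← Sym2.mem_toFinset, hcard e he, hcard f hf]

theorem card_coveredVertices_le (T : Finset (Sym2 (Fin k))) :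
    (coveredVertices T).card ≤ T.card * 2 := by
  refine card_biUnion_le_card_mul _ _ _ fun e _ => ?_
  rw [Sym2.card_toFinset]; split_ifs <;> omega

theorem card_sub_one_div_m2_le {T : Finset (Sym2 (Fin k))} (hT : T ⊆ H.edgeFinset)
    (hne : T.Nonempty) : ((T.card : ℝ) - 1) * (1 / m2 H) ≤ (coveredVertices T).card - 2 := by
  by_cases h : 2 ≤ T.card
  · have h3 := three_le_card_coveredVertices hT h
    have hle := le_m2 hT h3
    have h3' : (3 : ℝ) ≤ (coveredVertices T).card := by exact_mod_cast h3
    have h2' : (2 : ℝ) ≤ T.card := by exact_mod_cast h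
    have hpos : 0 < m2 H := lt_of_lt_of_le (div_pos (by linarith) (by linarith)) hle
    rw [div_le_iff₀ (by linarith)] at hle
    rw [mul_one_div, div_le_iff₀ hpos]
    linarith
  · have h1 : T.card = 1 := by have := hne.card_pos; omega
    have h2 : (2 : ℝ) ≤ (coveredVertices T).card := by
      exact_mod_cast two_le_card_coveredVertices hT hne
    rw [h1, Nat.cast_one, sub_self, zero_mul]; linarith

variable (H)

theorem two_sub_inv_m2_nonneg : 0 ≤ 2 - 1 / m2 H := by
  by_cases h : 2 ≤ H.edgeFinset.card
  · obtain ⟨T, hT, hTc⟩ := exists_subset_card_eq h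
    have h1 := card_sub_one_div_m2_le hT (card_pos.1 (by omega))
    have h2 : ((coveredVertices T).card : ℝ) ≤ T.card * 2 := by
      exact_mod_cast card_coveredVertices_le T
    rw [hTc] at h1 h2
    push_cast at h1 h2
    linarith
  · have : m2 H ≤ 0 := by
      refine Real.sSup_nonpos ?_
      rintro x ⟨H', S, hH', -, hS, rfl⟩
      have h1 : H'.edgeFinset.card ≤ 1 :=
        (card_le_card (SimpleGraph.edgeFinset_subset_edgeFinset.2 hH')).trans (by omega)
      have h1' : (H'.edgeFinset.card : ℝ) ≤ 1 := by exact_mod_cast h1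
      have hS' : (3 : ℝ) ≤ S.card := by exact_mod_cast hS
      exact div_nonpos_of_nonpos_of_nonneg (by linarith) (by linarith)
    have := one_div_nonpos.2 this
    linarith

variable {n : ℕ}

/-- The edges of the canonical copy of `H` in which the vertex `i` is played by the
`x i`-th vertex of the `i`-th part. -/
noncomputable def copyEdges (x : Fin k → Fin n) : Finset (Sym2 (Fin k × Fin n)) :=
  H.edgeFinset.image (Sym2.map fun i => (i, x i))

theorem card_copyEdges (x : Fin k → Fin n) : (copyEdges H x).card = H.edgeFinset.card := by
  refine card_image_of_injective _ (Sym2.map.injective fun i j h => ?_)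
  exact congrArg Prod.fst h

/-- The canonical copies of `H` inside `B` as a weighted hypergraph. -/
noncomputable def copyWeight (B e : Finset (Sym2 (Fin k × Fin n))) : ℝ :=
  ((univ.filter fun x : Fin k → Fin n => copyEdges H x = e ∧ e ⊆ B).card : ℝ)

theorem wdeg_copyWeight (B T : Finset (Sym2 (Fin k × Fin n))) :
    wdeg (copyWeight H B) T =
      ((univ.filter fun x : Fin k → Fin n => T ⊆ copyEdges H x ∧ copyEdges H x ⊆ B).card : ℝ) := by
  simp only [wdeg, copyWeight]
  rw [card_eq_sum_card_fiberwise (f := copyEdges H) (t := univ.filter (T ⊆ ·))]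
  · push_cast
    refine sum_congr rfl fun e he => ?_
    congr 2
    ext x
    simp only [mem_filter, mem_univ, true_and] at he ⊢
    constructor
    · rintro ⟨rfl, h⟩; exact ⟨⟨he, h⟩, rfl⟩
    · rintro ⟨⟨_, h⟩, rfl⟩; exact ⟨rfl, h⟩
  · intro x hx
    have := (mem_filter.1 (mem_coe.1 hx)).2.1
    simpa using this

variable {H}

theorem card_filter_subset_copyEdges_le (x₀ : Fin k → Fin n) (T : Finset (Sym2 (Fin k))) :
    (univ.filter fun x : Fin k → Fin n =>
      T.image (Sym2.map fun i => (i, x₀ i)) ⊆ copyEdges H x).card ≤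
      n ^ (k - (coveredVertices T).card) := by
  have h1 : (univ.filter fun x : Fin k → Fin n =>
      T.image (Sym2.map fun i => (i, x₀ i)) ⊆ copyEdges H x) ⊆
      Fintype.piFinset fun i => if i ∈ coveredVertices T then {x₀ i} else univ := by
    intro x hx
    have hx := (mem_filter.1 hx).2
    rw [Fintype.mem_piFinset]
    intro i
    split_ifs with hi
    · obtain ⟨e, he, hie⟩ := mem_coveredVertices.1 hi
      obtain ⟨f, -, hf⟩ := mem_image.1 (hx (mem_image_of_mem _ he))
      have h2 : (i, x₀ i) ∈ Sym2.map (fun i => (i, x₀ i)) e := Sym2.mem_map.2 ⟨i, hie, rfl⟩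
      rw [← hf, Sym2.mem_map] at h2
      obtain ⟨j, -, hj⟩ := h2
      obtain ⟨rfl, h3⟩ := Prod.mk.inj hj
      exact mem_singleton.2 h3
    · exact mem_univ _
  refine (card_le_card h1).trans_eq ?_
  rw [Fintype.card_piFinset]
  have : ∀ i, (if i ∈ coveredVertices T then {x₀ i} else (univ : Finset (Fin n))).card =
      if i ∈ coveredVertices T then 1 else n := by
    intro i; split_ifs <;> simp
  simp only [this, prod_ite, prod_const_one, one_mul, prod_const]
  congr 1
  rw [filter_not, card_sdiff_of_subset (filter_subset _ _)]
  simp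

theorem wdeg_copyWeight_le (hn : 1 ≤ n) (B : Finset (Sym2 (Fin k × Fin n)))
    {T : Finset (Sym2 (Fin k × Fin n))} (hT : T.Nonempty) :
    wdeg (copyWeight H B) T * ((n : ℝ) ^ 2 * (n : ℝ) ^ (-(1 / m2 H))) ≤
      (n : ℝ) ^ k * ((n : ℝ) ^ (-(1 / m2 H))) ^ T.card := by
  have hn0 : (0 : ℝ) < n := by exact_mod_cast hn
  have hn1 : (1 : ℝ) ≤ n := by exact_mod_cast hn
  rw [wdeg_copyWeight]
  by_cases hex : ∃ x₀ : Fin k → Fin n, T ⊆ copyEdges H x₀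
  · obtain ⟨x₀, hx₀⟩ := hex
    obtain ⟨T', hT', rfl⟩ := subset_image_iff.1 hx₀
    have hT'c : (T'.image (Sym2.map fun i => (i, x₀ i))).card = T'.card := by
      refine card_image_of_injective _ (Sym2.map.injective fun i j h => ?_)
      exact congrArg Prod.fst h
    have hsub : T' ⊆ H.edgeFinset := by exact_mod_cast hT'
    have h1 := card_sub_one_div_m2_le hsub (image_nonempty.1 hT)
    have h2 : (coveredVertices T').card ≤ k := by simpa using card_le_univ (coveredVertices T')
    have h3 : ((univ.filter fun x : Fin k → Fin n =>
        T'.image (Sym2.map fun i => (i, x₀ i)) ⊆ copyEdges H x ∧ copyEdges H x ⊆ B).card : ℝ) ≤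
        (n : ℝ) ^ (k - (coveredVertices T').card) := by
      refine le_trans ?_ (by exact_mod_cast card_filter_subset_copyEdges_le x₀ T' :
        ((univ.filter fun x : Fin k → Fin n =>
          T'.image (Sym2.map fun i => (i, x₀ i)) ⊆ copyEdges H x).card : ℝ) ≤ _)
      refine Nat.cast_le.2 (card_le_card fun x hx => ?_)
      exact mem_filter.2 ⟨mem_univ _, (mem_filter.1 hx).2.1⟩
    rw [hT'c]
    calc _ ≤ (n : ℝ) ^ (k - (coveredVertices T').card) *
          ((n : ℝ) ^ 2 * (n : ℝ) ^ (-(1 / m2 H))) := by gcongr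
      _ = (n : ℝ) ^ ((k : ℝ) - (coveredVertices T').card + (2 + -(1 / m2 H))) := by
        rw [← Real.rpow_natCast, ← Real.rpow_natCast, ← Real.rpow_add hn0, ← Real.rpow_add hn0,
          Nat.cast_sub h2]
        norm_num
      _ ≤ (n : ℝ) ^ ((k : ℝ) + -(1 / m2 H) * T'.card) := by
        apply Real.rpow_le_rpow_of_exponent_le hn1
        linarith
      _ = _ := by
        rw [Real.rpow_add hn0, Real.rpow_mul hn0.le, Real.rpow_natCast, Real.rpow_natCast]
  · rw [filter_eq_empty_iff.2 fun x _ h => hex ⟨x, h.1⟩]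
    simp only [card_empty, Nat.cast_zero, zero_mul]
    positivity

end

theorem card_sym2_fin_prod_le (k : ℕ) {n : ℕ} (hn : 1 ≤ n) :
    Fintype.card (Sym2 (Fin k × Fin n)) ≤ (k + 1) ^ 2 * n ^ 2 := by
  rw [Sym2.card, Fintype.card_prod, Fintype.card_fin, Fintype.card_fin, Nat.choose_two_right]
  refine Nat.div_le_of_le_mul ?_
  simp only [Nat.add_sub_cancel]
  nlinarith [Nat.zero_le k, Nat.zero_le (k * n), Nat.zero_le (k * n ^ 2), mul_le_mul hn hn]

/-- Graphs without canonical copies of `H` have small fingerprints whose containers have few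
canonical copies of `H`. -/
theorem exists_copy_containers {k : ℕ} (H : SimpleGraph (Fin k)) (ξ : ℝ) (hξ : 0 < ξ) :
    ∃ L : ℝ, 0 < L ∧ ∀ n : ℕ, 1 ≤ n →
      HasContainers (fun I : Finset (Sym2 (Fin k × Fin n)) => ∀ x, ¬ copyEdges H x ⊆ I)
        (L * (n : ℝ) ^ (2 - 1 / m2 H))
        (fun B => ((univ.filter fun x : Fin k → Fin n => copyEdges H x ⊆ B).card : ℝ)
          < ξ * n ^ k) := by
  set ℓ := H.edgeFinset.card with hℓ
  obtain ⟨δ, hδ, hmain⟩ := hypergraph_container ℓ (max 1 ((k + 1) ^ 2 / ξ)) (le_max_left _ _)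
  set J := ⌈1 / δ⌉₊ with hJ
  refine ⟨(J + 1) * (ℓ * (4 * (k + 1) ^ 2 + 1)) + 1, by positivity, fun n hn => ?_⟩
  have hn0 : (0 : ℝ) < n := by exact_mod_cast hn
  have hn1 : (1 : ℝ) ≤ n := by exact_mod_cast hn
  set p : ℝ := (n : ℝ) ^ (-(1 / m2 H)) with hp
  have hp0 : 0 < p := Real.rpow_pos_of_pos hn0 _
  set N : ℝ := (k + 1) ^ 2 * n ^ 2 with hN
  have hN0 : 0 < N := by positivity
  set D : ℝ := ξ * n ^ k / (N * p) with hD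
  have hD0 : 0 < D := by positivity
  set s : ℝ := ℓ * (4 * p * N + 1) with hs
  have hs0 : 0 ≤ s := by positivity
  have huniv : ((univ : Finset (Sym2 (Fin k × Fin n))).card : ℝ) ≤ N := by
    rw [hN]; exact_mod_cast card_sym2_fin_prod_le k hn
  have step : ∀ (B : Finset (Sym2 (Fin k × Fin n))) (t : ℝ), 0 ≤ t →
      (∀ B' : Finset (Sym2 (Fin k × Fin n)), δ * N ≤ (B \ B').card →
        HasContainers (fun I => ((∀ x, ¬ copyEdges H x ⊆ I) ∧ I ⊆ B) ∧ I ⊆ B') t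
          (fun B => ((univ.filter fun x : Fin k → Fin n => copyEdges H x ⊆ B).card : ℝ)
          < ξ * n ^ k)) →
      HasContainers (fun I => (∀ x, ¬ copyEdges H x ⊆ I) ∧ I ⊆ B) (s + t)
        (fun B => ((univ.filter fun x : Fin k → Fin n => copyEdges H x ⊆ B).card : ℝ)
          < ξ * n ^ k) := by
    intro B t ht hcont
    by_cases hgood : ((univ.filter fun x : Fin k → Fin n => copyEdges H x ⊆ B).card : ℝ)
        < ξ * n ^ k
    · refine ⟨fun _ => B, fun I hI => ⟨∅, empty_subset _, by simp; positivity, ?_, hgood⟩⟩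
      simpa using hI.2
    push Not at hgood
    have hindep : ∀ I, ((∀ x, ¬ copyEdges H x ⊆ I) ∧ I ⊆ B) →
        ((∀ x, ¬ copyEdges H x ⊆ I) ∧ I ⊆ B) ∧ Indep (copyWeight H B) I := by
      rintro I ⟨h1, h2⟩
      refine ⟨⟨h1, h2⟩, fun e he => ?_⟩
      rw [copyWeight, filter_eq_empty_iff.2]
      · simp
      · rintro x - ⟨rfl, -⟩
        exact h1 x he
    refine (hmain B (copyWeight H B) N p D t (fun I => (∀ x, ¬ copyEdges H x ⊆ I) ∧ I ⊆ B) _ hN0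
      (le_trans (by exact_mod_cast card_le_card (subset_univ B)) huniv)
      hp0 hD0 (fun e => by unfold copyWeight; positivity) ?_ ?_ ?_ ?_ hcont).mono hindep le_rfl
    · intro e he
      have : (univ.filter fun x : Fin k → Fin n => copyEdges H x = e ∧ e ⊆ B).Nonempty := by
        rw [nonempty_iff_ne_empty]
        intro h0
        exact he (by simp [copyWeight, h0])
      obtain ⟨x, hx⟩ := this
      obtain ⟨rfl, h2⟩ := (mem_filter.1 hx).2
      exact ⟨h2, card_copyEdges H x⟩
    · rw [← wdeg_empty, wdeg_copyWeight]
      simp only [empty_subset, true_and]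
      refine le_trans (le_of_eq ?_) hgood
      rw [hD]; field_simp
    · intro T hT
      have h1 := wdeg_copyWeight_le (H := H) hn B hT
      rw [← hp] at h1
      have h2 : (k + 1) ^ 2 / ξ * D * p ^ T.card ≤
          max 1 ((k + 1) ^ 2 / ξ) * D * p ^ T.card := by
        gcongr; exact le_max_right _ _
      refine le_trans ?_ h2
      have h3 : ((k : ℝ) + 1) ^ 2 / ξ * D * p ^ T.card =
          n ^ k * p ^ T.card / (n ^ 2 * p) := by
        rw [hD, hN]; field_simp
      rw [h3, le_div_iff₀ (by positivity)]
      exact h1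
    · rintro I I' hI' ⟨h1, h2⟩
      exact ⟨fun x hx => h1 x (hx.trans hI'), hI'.trans h2⟩
  have key : ∀ (j : ℕ) (B : Finset (Sym2 (Fin k × Fin n))), (B.card : ℝ) ≤ j * (δ * N) →
      HasContainers (fun I => (∀ x, ¬ copyEdges H x ⊆ I) ∧ I ⊆ B) ((j + 1) * s)
        (fun B => ((univ.filter fun x : Fin k → Fin n => copyEdges H x ⊆ B).card : ℝ)
          < ξ * n ^ k) := by
    intro j
    induction j with
    | zero =>
      intro B hB
      refine (step B 0 le_rfl fun B' hB' => ?_).mono (fun _ hI => hI) (by simp)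
      exfalso
      have h1 : ((B \ B').card : ℝ) ≤ B.card := by
        exact_mod_cast card_le_card sdiff_subset
      have h2 : 0 < δ * N := by positivity
      simp only [Nat.cast_zero, zero_mul] at hB
      linarith
    | succ j ih =>
      intro B hB
      refine (step B ((j + 1) * s) (by positivity) fun B' hB' => ?_).mono (fun _ hI => hI)
        (by push_cast; linarith)
      refine (ih (B ∩ B') ?_).mono (fun I hI => ⟨hI.1.1, subset_inter hI.1.2 hI.2⟩) le_rfl
      have h1 : (((B \ B').card : ℝ) + (B ∩ B').card) = B.card := by
        exact_mod_cast card_sdiff_add_card_inter B B'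
      push_cast at hB
      linarith
  refine (key J univ ?_).mono (fun I hI => ⟨hI, subset_univ _⟩) ?_
  · refine huniv.trans ?_
    have h1 : 1 / δ ≤ J := Nat.le_ceil _
    rw [div_le_iff₀ hδ] at h1
    nlinarith
  · have hexp : (n : ℝ) ^ (2 - 1 / m2 H) = n ^ 2 * p := by
      rw [sub_eq_add_neg, Real.rpow_add hn0, Real.rpow_two]
    have h1 : (1 : ℝ) ≤ (n : ℝ) ^ (2 - 1 / m2 H) :=
      Real.one_le_rpow hn1 (two_sub_inv_m2_nonneg H)
    rw [hexp] at h1 ⊢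
    have h2 : 4 * p * N + 1 ≤ (4 * (k + 1) ^ 2 + 1) * (n ^ 2 * p) := by
      rw [hN]; linarith
    have h3 : ((J : ℝ) + 1) * s ≤ (J + 1) * (ℓ * ((4 * (k + 1) ^ 2 + 1) * (n ^ 2 * p))) := by
      rw [hs]; gcongr
    nlinarith

/-- If every member `I` of a family of transversal sets contains a set `S` together with `q S`
elements of a set `Z S` avoiding `S`, then the family is small as soon as the sets `Z S` are. -/
theorem card_le_of_fingerprints {V ι : Type} [Fintype V] [DecidableEq V] [DecidableEq ι]
    (π : V → ι) (E : Finset ι) (M m : ℕ)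
    (hM : ∀ e ∈ E, (univ.filter fun v => π v = e).card ≤ M) (hm : m ≤ M)
    (P : Finset V → Prop) (Z : Finset V → Finset V) (q : Finset V → ℕ) (c : ℝ) (hc : 0 ≤ c)
    (hZ : ∀ S, P S → ((Z S).card.choose (q S) : ℝ) * ((m : ℝ) / M) ^ q S ≤ c)
    (𝒢 : Finset (Finset V)) (h𝒢 : 𝒢 ⊆ transversalFamily π E m)
    (h : ∀ I ∈ 𝒢, ∃ S ⊆ I, P S ∧ ∃ Q ⊆ I, Q ⊆ Z S ∧ Disjoint S Q ∧ Q.card = q S) :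
    (𝒢.card : ℝ) ≤
      Real.exp (Fintype.card V * ((m : ℝ) / M)) * c * (M.choose m : ℝ) ^ E.card := by
  set x : ℝ := (m : ℝ) / M with hx
  have hx0 : 0 ≤ x := by positivity
  have hsub : 𝒢 ⊆ (univ.filter P).biUnion fun S =>
      ((powersetCard (q S) (Z S)).filter (Disjoint S ·)).biUnion fun Q =>
        (transversalFamily π E m).filter (S ∪ Q ⊆ ·) := by
    intro I hI
    obtain ⟨S, hS, hP, Q, hQ, hQZ, hd, hq⟩ := h I hI
    simp only [mem_biUnion, mem_filter, mem_univ, true_and, mem_powersetCard]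
    exact ⟨S, hP, Q, ⟨⟨hQZ, hq⟩, hd⟩, h𝒢 hI, union_subset hS hQ⟩
  have hbound : ∀ S, P S → ∀ Q ∈ (powersetCard (q S) (Z S)).filter (Disjoint S ·),
      (((transversalFamily π E m).filter (S ∪ Q ⊆ ·)).card : ℝ) ≤
        x ^ S.card * x ^ q S * (M.choose m : ℝ) ^ E.card := by
    intro S _ Q hQ
    obtain ⟨hQ, hd⟩ := mem_filter.1 hQ
    refine (card_transversalFamily_superset_le π E M m hM hm (S ∪ Q)).trans_eq ?_
    rw [card_union_of_disjoint hd, (mem_powersetCard.1 hQ).2, pow_add]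
  have hsum : ∀ S ∈ univ.filter P,
      ((((powersetCard (q S) (Z S)).filter (Disjoint S ·)).biUnion fun Q =>
        (transversalFamily π E m).filter (S ∪ Q ⊆ ·)).card : ℝ) ≤
        x ^ S.card * (c * (M.choose m : ℝ) ^ E.card) := by
    intro S hS
    have hP := (mem_filter.1 hS).2
    have h1 := (Nat.cast_le (α := ℝ)).2 (card_biUnion_le
      (s := (powersetCard (q S) (Z S)).filter (Disjoint S ·))
      (t := fun Q => (transversalFamily π E m).filter (S ∪ Q ⊆ ·)))
    rw [Nat.cast_sum] at h1
    refine (h1.trans (sum_le_card_nsmul _ _ _ (hbound S hP))).trans ?_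
    have h2 : (((powersetCard (q S) (Z S)).filter (Disjoint S ·)).card : ℝ) ≤
        (Z S).card.choose (q S) := by
      rw [← card_powersetCard]; exact_mod_cast card_le_card (filter_subset _ _)
    rw [nsmul_eq_mul]
    calc _ ≤ ((Z S).card.choose (q S) : ℝ) *
          (x ^ S.card * x ^ q S * (M.choose m : ℝ) ^ E.card) := by gcongr
      _ = x ^ S.card * (((Z S).card.choose (q S) * x ^ q S) * (M.choose m : ℝ) ^ E.card) := by
        ring
      _ ≤ _ := by gcongr; exact hZ S hP
  have h1 := (Nat.cast_le (α := ℝ)).2 ((card_le_card hsub).trans card_biUnion_le)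
  rw [Nat.cast_sum] at h1
  refine (h1.trans (sum_le_sum hsum)).trans ?_
  rw [← sum_mul, mul_assoc]
  gcongr
  calc _ ≤ ∑ S : Finset V, x ^ S.card :=
        sum_le_sum_of_subset_of_nonneg (filter_subset _ _) fun S _ _ => by positivity
    _ = (x + 1) ^ Fintype.card V := by
        rw [← Fintype.sum_pow_mul_eq_add_pow]; simp
    _ ≤ Real.exp x ^ Fintype.card V := by gcongr; exact Real.add_one_le_exp x
    _ = _ := by rw [← Real.exp_nat_mul]

section
variable {k n : ℕ}

/-- The potential edges between the copies of `A` in part `i` and of `A'` in part `j`. -/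
noncomputable def pairEdges (i j : Fin k) (A A' : Finset (Fin n)) :
    Finset (Sym2 (Fin k × Fin n)) :=
  (A ×ˢ A').image fun z => s((i, z.1), (j, z.2))

theorem sym2_mk_injective {i j : Fin k} (hij : i ≠ j) :
    Function.Injective fun z : Fin n × Fin n => s((i, z.1), (j, z.2)) := by
  rintro ⟨a, b⟩ ⟨a', b'⟩ h
  simp only [Sym2.eq_iff, Prod.mk.injEq] at h
  grind

theorem card_pairEdges_univ_le (i j : Fin k) :
    (pairEdges i j univ univ : Finset (Sym2 (Fin k × Fin n))).card ≤ n ^ 2 := by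
  refine card_image_le.trans_eq ?_
  simp [sq]

theorem filter_map_fst_eq (i j : Fin k) (I : Finset (Sym2 (Fin k × Fin n))) :
    (I.filter fun v => Sym2.map Prod.fst v = s(i, j)) = I ∩ pairEdges i j univ univ := by
  ext v
  rw [mem_filter, mem_inter]
  refine and_congr_right fun _ => ?_
  induction v with
  | _ a b
  obtain ⟨a, x⟩ := a
  obtain ⟨b, y⟩ := b
  simp only [pairEdges, Sym2.map_mk, Sym2.eq_iff, mem_image, Prod.mk.injEq]
  constructor
  · rintro (⟨rfl, rfl⟩ | ⟨rfl, rfl⟩)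
    · exact ⟨(x, y), by simp, by simp⟩
    · exact ⟨(y, x), by simp, by simp⟩
  · rintro ⟨⟨x', y'⟩, -, h⟩
    grind

theorem eBetween_eq_card_inter (G : SimpleGraph (Fin k × Fin n)) (i j : Fin k)
    (A A' : Finset (Fin n)) :
    eBetween G (A.image (Prod.mk i)) (A'.image (Prod.mk j)) =
      (G.edgeFinset ∩ pairEdges i j A A').card := by
  unfold eBetween
  congr 1
  ext v
  simp only [mem_filter, mem_inter, pairEdges, mem_image, mem_product]
  refine and_congr_right fun _ => ?_
  constructor
  · rintro ⟨_, ⟨a, ha, rfl⟩, _, ⟨b, hb, rfl⟩, rfl⟩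
    exact ⟨(a, b), ⟨ha, hb⟩, rfl⟩
  · rintro ⟨⟨a, b⟩, ⟨ha, hb⟩, rfl⟩
    exact ⟨_, ⟨a, ha, rfl⟩, _, ⟨b, hb, rfl⟩, rfl⟩

theorem part_eq_image (i : Fin k) :
    (part i : Finset (Fin k × Fin n)) = univ.image (Prod.mk i) := by
  ext ⟨a, x⟩
  simp [part, eq_comm]

theorem card_image_mk (i : Fin k) (A : Finset (Fin n)) : (A.image (Prod.mk i)).card = A.card :=
  card_image_of_injective _ (Prod.mk_right_injective i)

variable {H : SimpleGraph (Fin k)} {m : ℕ} {ε : ℝ} {G : SimpleGraph (Fin k × Fin n)}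

theorem edgeFinset_mem_transversalFamily (hG : G ∈ GFamily H n m ε) :
    G.edgeFinset ∈ transversalFamily (Sym2.map Prod.fst) H.edgeFinset m := by
  simp only [transversalFamily, mem_filter, mem_univ, true_and]
  refine ⟨fun v hv => ?_, fun e he => ?_⟩
  · induction v with
    | _ a b
    rw [SimpleGraph.mem_edgeFinset, SimpleGraph.mem_edgeSet] at hv
    rw [Sym2.map_mk, SimpleGraph.mem_edgeFinset, SimpleGraph.mem_edgeSet]
    exact hG.1 a b hv
  · induction e with
    | _ i j
    rw [SimpleGraph.mem_edgeFinset, SimpleGraph.mem_edgeSet] at he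
    rw [filter_map_fst_eq, ← eBetween_eq_card_inter, ← part_eq_image, ← part_eq_image]
    exact (hG.2 i j he).1

theorem le_sq_of_mem_GFamily (hG : G ∈ GFamily H n m ε) {i j : Fin k} (hij : H.Adj i j) :
    m ≤ n ^ 2 := by
  rw [← (hG.2 i j hij).1, part_eq_image, part_eq_image, eBetween_eq_card_inter]
  exact (card_le_card inter_subset_right).trans (card_pairEdges_univ_le i j)

theorem containsCopy_of_copyEdges_subset {x : Fin k → Fin n}
    (h : copyEdges H x ⊆ G.edgeFinset) : ContainsCopy H G := by
  refine ⟨fun i => (i, x i), fun i j h => congrArg Prod.fst h, fun a b hab => ?_⟩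
  have : s((a, x a), (b, x b)) ∈ G.edgeFinset :=
    h (mem_image.2 ⟨s(a, b), by simpa using hab, rfl⟩)
  simpa using this

theorem copyEdges_subset_iff {x : Fin k → Fin n} {B : Finset (Sym2 (Fin k × Fin n))} :
    copyEdges H x ⊆ B ↔ ∀ i j, i < j → H.Adj i j → s((i, x i), (j, x j)) ∈ B := by
  constructor
  · intro h i j _ hij
    exact h (mem_image.2 ⟨s(i, j), by simpa using hij, rfl⟩)
  · intro h v hv
    obtain ⟨e, he, rfl⟩ := mem_image.1 hv
    induction e with
    | _ i j
    rw [SimpleGraph.mem_edgeFinset, SimpleGraph.mem_edgeSet] at he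
    rcases he.ne.lt_or_gt with hlt | hlt
    · exact h i j hlt he
    · rw [Sym2.eq_swap]; exact h j i hlt he.symm

theorem le_card_inter_pairEdges (hG : G ∈ GFamily H n m ε) {i j : Fin k}
    (hij : H.Adj i j) {A A' : Finset (Fin n)} (hA : ε * n ≤ A.card) (hA' : ε * n ≤ A'.card) :
    (1 - ε) * (A.card * A'.card * ((m : ℝ) / n ^ 2)) ≤
      ((G.edgeFinset ∩ pairEdges i j A A').card : ℝ) := by
  obtain ⟨h1, h2⟩ := hG.2 i j hij
  have hpart : ∀ (i : Fin k) (A : Finset (Fin n)), A.image (Prod.mk i) ⊆ part i := fun i A => by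
    rw [part_eq_image]; exact image_subset_image (subset_univ _)
  have hcard : ∀ i : Fin k, (part i : Finset (Fin k × Fin n)).card = n := fun i => by
    rw [part_eq_image, card_image_mk]; simp
  have h3 := h2 _ (hpart i A) _ (hpart j A') (by rwa [hcard, card_image_mk])
    (by rwa [hcard, card_image_mk])
  have h4 : pairDensity G (part i) (part j) = (m : ℝ) / n ^ 2 := by
    rw [pairDensity, h1]
    rw [hcard, hcard, sq]
  rw [h4, eBetween_eq_card_inter, card_image_mk, card_image_mk] at h3
  have := (abs_le.1 h3).1
  linarith

end

theorem exists_adj_of_gStarFamily_nonempty {k n m : ℕ} {ε : ℝ} {H : SimpleGraph (Fin k)}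
    (hn : 1 ≤ n) (h : (GStarFamily H n m ε).Nonempty) : ∃ i j, H.Adj i j := by
  obtain ⟨G, -, hG⟩ := h
  by_contra! hH
  exact hG ⟨fun i => (i, ⟨0, hn⟩), fun i j h => congrArg Prod.fst h,
    fun a b hab => (hH a b hab).elim⟩

/-- A container with few canonical copies of `H` has a sparse spot, from which every graph of the
family with a small fingerprint `S` has to pick many edges. -/
theorem exists_sparse_spot {k : ℕ} (H : SimpleGraph (Fin k)) {b : ℝ} (hb : 0 < b) (hb1 : b ≤ 1) :
    ∃ ξ α₀ : ℝ, 0 < ξ ∧ 0 < α₀ ∧ ∀ n m : ℕ, 1 ≤ n → ∀ B : Finset (Sym2 (Fin k × Fin n)),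
      ((univ.filter fun x : Fin k → Fin n => copyEdges H x ⊆ B).card : ℝ) < ξ * n ^ k →
      ∃ (Z : Finset (Sym2 (Fin k × Fin n))) (q : ℕ),
        (Z.card.choose q : ℝ) * ((m : ℝ) / (n ^ 2 : ℕ)) ^ q ≤ b ^ m ∧
        ∀ G ∈ GFamily H n m (min α₀ (1 / 2)), ∀ S : Finset (Sym2 (Fin k × Fin n)),
          (S.card : ℝ) ≤ α₀ ^ 2 / 4 * m → G.edgeFinset \ S ⊆ B →
          ∃ Q ⊆ G.edgeFinset, Q ⊆ Z ∧ Disjoint S Q ∧ Q.card = q := by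
  obtain ⟨ξ, α₀, hξ, hα₀, hC⟩ := exists_many_copies_or_sparse_pair
    (fun α => b ^ ⌈4 / α ^ 2⌉₊ / (4 * Real.exp 1)) (fun α _ => by positivity) k 1 one_pos
  refine ⟨ξ, α₀, hξ, hα₀, fun n m hn B hB => ?_⟩
  have hn0 : (0 : ℝ) < n := by exact_mod_cast hn
  rcases hC H.Adj n (fun i j a b => s((i, a), (j, b)) ∈ B) (fun _ => univ) (by simp) with h | h
  · refine absurd h (not_le.2 (lt_of_eq_of_lt ?_ hB))
    congr 2
    ext x
    simp only [mem_filter, mem_univ, true_and, implies_true, copyEdges_subset_iff]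
  obtain ⟨i, j, hlt, hij, α, hα, A, A', hA, hA', hsparse⟩ := h
  have hα0 : 0 < α := hα₀.trans_le hα
  set t : ℝ := A.card * A'.card with ht
  set X : ℝ := (m : ℝ) / n ^ 2 with hX
  have hX0 : 0 ≤ X := by positivity
  have htn : α ^ 2 * n ^ 2 ≤ t := by
    rw [ht, ← mul_pow, sq]
    exact mul_le_mul hA hA' (by positivity) (by positivity)
  have htX : α ^ 2 * m ≤ t * X := by
    have : α ^ 2 * m = α ^ 2 * n ^ 2 * X := by rw [hX]; field_simp
    rw [this]; gcongr
  have hZcard : ((B ∩ pairEdges i j A A').card : ℝ) ≤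
      b ^ ⌈4 / α ^ 2⌉₊ / (4 * Real.exp 1) * t := by
    refine le_trans ?_ hsparse
    rw [← card_image_of_injective _ (sym2_mk_injective (n := n) hlt.ne)]
    refine Nat.cast_le.2 (card_le_card fun v hv => ?_)
    obtain ⟨hvB, hv⟩ := mem_inter.1 hv
    obtain ⟨z, hz, rfl⟩ := mem_image.1 hv
    refine mem_image.2 ⟨z, ?_, rfl⟩
    simp only [mem_filter]
    exact ⟨hz, hvB⟩
  have hq : t * X / 4 ≤ (⌈t * X / 4⌉₊ : ℝ) := Nat.le_ceil _
  refine ⟨B ∩ pairEdges i j A A', ⌈t * X / 4⌉₊, ?_, fun G hG S hS hGS => ?_⟩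
  · rw [Nat.cast_pow, ← hX]
    refine (choose_mul_pow_le _ _ X hX0 (b ^ ⌈4 / α ^ 2⌉₊) ?_).trans ?_
    · calc _ ≤ Real.exp 1 * (b ^ ⌈4 / α ^ 2⌉₊ / (4 * Real.exp 1) * t) * X := by gcongr
        _ = b ^ ⌈4 / α ^ 2⌉₊ * (t * X / 4) := by field_simp
        _ ≤ _ := by gcongr
    · rw [← pow_mul]
      refine pow_le_pow_of_le_one hb.le hb1 ?_
      have h1 : 4 / α ^ 2 ≤ (⌈4 / α ^ 2⌉₊ : ℝ) := Nat.le_ceil _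
      have h2 : (m : ℝ) ≤ ⌈4 / α ^ 2⌉₊ * ⌈t * X / 4⌉₊ := by
        calc (m : ℝ) = 4 / α ^ 2 * (α ^ 2 * m / 4) := by field_simp
          _ ≤ _ := by gcongr; exact (by linarith : α ^ 2 * m / 4 ≤ t * X / 4).trans hq
      exact_mod_cast h2
  · have hε : min α₀ (1 / 2) * n ≤ α * n := by
      gcongr; exact (min_le_left _ _).trans hα
    have h1 := le_card_inter_pairEdges hG hij (hε.trans hA) (hε.trans hA')
    rw [← ht, ← hX] at h1
    have h2 : 1 / 2 * (t * X) ≤ (1 - min α₀ (1 / 2)) * (t * X) := by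
      gcongr; linarith [min_le_right α₀ (1 / 2)]
    have h3 : α₀ ^ 2 * m ≤ t * X := le_trans (by gcongr) htX
    have h4 : ((G.edgeFinset ∩ pairEdges i j A A').card : ℝ) ≤
        ((G.edgeFinset ∩ pairEdges i j A A') \ S).card + S.card := by
      exact_mod_cast card_le_card_sdiff_add_card
    have h5 : ⌈t * X / 4⌉₊ ≤ ((G.edgeFinset ∩ pairEdges i j A A') \ S).card :=
      Nat.ceil_le.2 (by linarith)
    obtain ⟨Q, hQ, hQc⟩ := exists_subset_card_eq h5
    refine ⟨Q, fun v hv => ?_, fun v hv => ?_, disjoint_right.2 fun v hv => ?_, hQc⟩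
    · exact (mem_inter.1 (mem_sdiff.1 (hQ hv)).1).1
    · obtain ⟨h6, h7⟩ := mem_sdiff.1 (hQ hv)
      obtain ⟨h8, h9⟩ := mem_inter.1 h6
      exact mem_inter.2 ⟨hGS (mem_sdiff.2 ⟨h8, h7⟩), h9⟩
    · exact (mem_sdiff.1 (hQ hv)).2

theorem statement_4 :
    ∀ (k : ℕ) (H : SimpleGraph (Fin k)) (β : ℝ), 0 < β →
      ∃ (C ε : ℝ) (n₀ : ℕ), 0 < C ∧ 0 < ε ∧ 0 < n₀ ∧
        ∀ n : ℕ, n₀ ≤ n →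
          ∀ m : ℕ, C * (n : ℝ) ^ ((2 : ℝ) - 1 / m2 H) ≤ (m : ℝ) →
            ((GStarFamily H n m ε).ncard : ℝ) ≤
              β ^ m * (((n ^ 2).choose m : ℝ)) ^ (H.edgeFinset.card) := by
  intro k H β hβ
  set b : ℝ := min 1 (β * Real.exp (-(k + 1) ^ 2)) with hb
  have hb0 : 0 < b := lt_min one_pos (by positivity)
  obtain ⟨ξ, α₀, hξ, hα₀, hspot⟩ := exists_sparse_spot H hb0 (min_le_left _ _)
  obtain ⟨L, hL, hcont⟩ := exists_copy_containers H ξ hξ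
  refine ⟨4 * L / α₀ ^ 2, min α₀ (1 / 2), 1, by positivity, by positivity, one_pos,
    fun n hn m hm => ?_⟩
  have hn0 : (0 : ℝ) < n := by exact_mod_cast hn
  rcases (GStarFamily H n m (min α₀ (1 / 2))).eq_empty_or_nonempty with h0 | hne
  · rw [h0, Set.ncard_empty, Nat.cast_zero]
    positivity
  obtain ⟨i, j, hij⟩ := exists_adj_of_gStarFamily_nonempty hn hne
  have hmn : m ≤ n ^ 2 := by
    obtain ⟨G, hG, -⟩ := hne
    exact le_sq_of_mem_GFamily hG hij
  have hs : L * (n : ℝ) ^ (2 - 1 / m2 H) ≤ α₀ ^ 2 / 4 * m := by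
    calc _ = α₀ ^ 2 / 4 * (4 * L / α₀ ^ 2 * (n : ℝ) ^ (2 - 1 / m2 H)) := by field_simp
      _ ≤ _ := by gcongr
  obtain ⟨F, hF⟩ := hcont n hn
  choose! Z q hZ hQ using fun S => hspot n m hn (F S)
  set 𝒢 := (univ.filter (· ∈ GStarFamily H n m (min α₀ (1 / 2)))).image
    fun G : SimpleGraph (Fin k × Fin n) => G.edgeFinset with h𝒢
  have hcard : (GStarFamily H n m (min α₀ (1 / 2))).ncard = 𝒢.card := by
    rw [h𝒢, card_image_of_injective _ fun G G' h => SimpleGraph.edgeFinset_inj.1 h,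
      ← Set.ncard_coe_finset]
    simp
  have hmain := card_le_of_fingerprints (Sym2.map Prod.fst) H.edgeFinset (n ^ 2) m ?_ hmn
    (fun S => ((univ.filter fun x : Fin k → Fin n => copyEdges H x ⊆ F S).card : ℝ) < ξ * n ^ k)
    Z q (b ^ m) (by positivity) hZ 𝒢 ?_ ?_
  · rw [hcard]
    refine hmain.trans ?_
    gcongr
    have h1 : (Fintype.card (Sym2 (Fin k × Fin n)) : ℝ) * ((m : ℝ) / (n ^ 2 : ℕ)) ≤
        m * (k + 1) ^ 2 := by
      have h2 : (Fintype.card (Sym2 (Fin k × Fin n)) : ℝ) ≤ (k + 1) ^ 2 * n ^ 2 := by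
        exact_mod_cast card_sym2_fin_prod_le k hn
      calc _ ≤ ((k : ℝ) + 1) ^ 2 * n ^ 2 * ((m : ℝ) / (n ^ 2 : ℕ)) := by gcongr
        _ = _ := by push_cast; field_simp
    calc _ ≤ Real.exp (m * (k + 1) ^ 2) * (β * Real.exp (-(k + 1) ^ 2)) ^ m := by
          gcongr; exact min_le_right _ _
      _ = β ^ m := by
          rw [mul_pow, ← Real.exp_nat_mul, mul_left_comm, ← Real.exp_add]
          simp
  · intro e _
    induction e with
    | _ i j
    rw [filter_map_fst_eq]
    exact (card_le_card inter_subset_right).trans (card_pairEdges_univ_le i j)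
  · intro I hI
    obtain ⟨G, hG, rfl⟩ := mem_image.1 hI
    exact edgeFinset_mem_transversalFamily (mem_filter.1 hG).2.1
  · intro I hI
    obtain ⟨G, hG, rfl⟩ := mem_image.1 hI
    obtain ⟨hG, hfree⟩ := (mem_filter.1 hG).2
    obtain ⟨S, hSG, hSc, hSF, hgood⟩ :=
      hF G.edgeFinset fun x hx => hfree (containsCopy_of_copyEdges_subset hx)
    exact ⟨S, hSG, hgood, hQ S hgood G hG S (hSc.trans hs) hSF⟩
end

section
/- Given a positive ε < 1/6, there exists a constant C such that any (ε)-regular bipartite graph B = (V₁ ∪ V₂, E) contains a (2ε)-regular subgraph B' = (V₁ ∪ V₂, E') with exactly |E'| = m edges, for every m satisfying C·|V(B)| ≤ m ≤ |E(B)|. -/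
/-!
Statement 6 (Lemma 3.3): for positive `ε < 1/6` there is a constant `C` such that any
`(ε)`-regular bipartite graph `B = (V₁ ∪ V₂, E)` contains a `(2ε)`-regular subgraph
`B' = (V₁ ∪ V₂, E')` with exactly `m` edges, for every `m` with `C|V(B)| ≤ m ≤ |E(B)|`.
-/

open Finset
open scoped Classical

/-- The number of edges of the bipartite graph with edge set `E` between `A ⊆ V₁`
and `B ⊆ V₂`. -/
noncomputable def bipCount {V₁ V₂ : Type} (E : Finset (V₁ × V₂))
    (A : Finset V₁) (B : Finset V₂) : ℕ :=
  (E.filter (fun e => e.1 ∈ A ∧ e.2 ∈ B)).card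

/-- The bipartite graph with parts `A`, `B` and edge set `E` is `(ε)`-regular:
for all `A' ⊆ A`, `B' ⊆ B` with `|A'| ≥ ε|A|` and `|B'| ≥ ε|B|` we have
`|e(A',B') − |A'||B'|p| ≤ ε|A'||B'|p` where `p = e(A,B)/(|A||B|)`. -/
noncomputable def BipRegular {V₁ V₂ : Type} (ε : ℝ) (A : Finset V₁) (B : Finset V₂)
    (E : Finset (V₁ × V₂)) : Prop :=
  ∀ A' ⊆ A, ∀ B' ⊆ B,
    ε * (A.card : ℝ) ≤ (A'.card : ℝ) → ε * (B.card : ℝ) ≤ (B'.card : ℝ) →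
    |(bipCount E A' B' : ℝ) -
        (A'.card : ℝ) * (B'.card : ℝ) * ((bipCount E A B : ℝ) / ((A.card : ℝ) * (B.card : ℝ)))| ≤
      ε * ((A'.card : ℝ) * (B'.card : ℝ) *
        ((bipCount E A B : ℝ) / ((A.card : ℝ) * (B.card : ℝ))))

/-- Drawing without replacement is dominated by drawing with replacement:
`m(m-1)⋯(m-j+1) / N(N-1)⋯(N-j+1) ≤ (m/N)^j`. -/
lemma descFactorial_mul_pow_le {m N : ℕ} (h : m ≤ N) (j : ℕ) :
    m.descFactorial j * N ^ j ≤ N.descFactorial j * m ^ j := by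
  induction j with
  | zero => simp
  | succ j ih =>
    rw [Nat.descFactorial_succ, Nat.descFactorial_succ, pow_succ, pow_succ]
    have h1 : (m - j) * N ≤ (N - j) * m := by
      rw [Nat.sub_mul, Nat.sub_mul, Nat.mul_comm m N]
      exact Nat.sub_le_sub_left (Nat.mul_le_mul_left j h) _
    calc (m - j) * m.descFactorial j * (N ^ j * N)
        = ((m - j) * N) * (m.descFactorial j * N ^ j) := by ring
      _ ≤ ((N - j) * m) * (N.descFactorial j * m ^ j) := Nat.mul_le_mul h1 ih
      _ = _ := by ring

lemma choose_sub_mul_pow_le {m N j : ℕ} (h : m ≤ N) (hj : j ≤ m) :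
    (N - j).choose (m - j) * N ^ j ≤ N.choose m * m ^ j := by
  have h1 := Nat.choose_mul (n := N) (k := m) (s := j) hj
  have h2 := descFactorial_mul_pow_le h j
  rw [Nat.descFactorial_eq_factorial_mul_choose, Nat.descFactorial_eq_factorial_mul_choose,
    mul_assoc, mul_assoc] at h2
  have h3 := Nat.le_of_mul_le_mul_left h2 (Nat.factorial_pos j)
  refine Nat.le_of_mul_le_mul_left ?_ (Nat.choose_pos (hj.trans h))
  calc N.choose j * ((N - j).choose (m - j) * N ^ j)
      = N.choose m * (m.choose j * N ^ j) := by rw [← mul_assoc, ← h1, mul_assoc]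
    _ ≤ N.choose m * (N.choose j * m ^ j) := Nat.mul_le_mul_left _ h3
    _ = _ := by ring

/-- The proportion of `m`-subsets of `E` containing a fixed set `T` is at most `(m/|E|)^|T|`. -/
lemma card_powersetCard_filter_superset_le {α : Type} [DecidableEq α] {E T : Finset α} {m : ℕ}
    (hT : T ⊆ E) (hm : m ≤ E.card) (hE : 0 < E.card) :
    (((E.powersetCard m).filter (T ⊆ ·)).card : ℝ) ≤
      (E.card.choose m : ℝ) * ((m : ℝ) / E.card) ^ T.card := by
  by_cases hj : T.card ≤ m
  · have h1 : ((E.powersetCard m).filter (T ⊆ ·)).card ≤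
        (E.card - T.card).choose (m - T.card) := by
      rw [← card_sdiff_of_subset hT, ← card_powersetCard]
      refine card_le_card_of_injOn (· \ T) ?_ ?_
      · intro X hX
        simp only [coe_filter, mem_powersetCard, Set.mem_ofPred_eq] at hX
        simp only [mem_coe, mem_powersetCard]
        exact ⟨sdiff_subset_sdiff hX.1.1 le_rfl, by rw [card_sdiff_of_subset hX.2, hX.1.2]⟩
      · intro X hX Y hY hXY
        simp only [coe_filter, mem_powersetCard, Set.mem_ofPred_eq] at hX hY
        rw [← sdiff_union_of_subset hX.2, ← sdiff_union_of_subset hY.2]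
        exact congrArg (· ∪ T) hXY
    have h2 := (Nat.mul_le_mul_right (E.card ^ T.card) h1).trans (choose_sub_mul_pow_le hm hj)
    have hE' : (0 : ℝ) < (E.card : ℝ) ^ T.card := by positivity
    rw [div_pow, ← mul_div_assoc, le_div_iff₀ hE']
    exact_mod_cast h2
  · have h0 : (E.powersetCard m).filter (T ⊆ ·) = ∅ := by
      refine filter_eq_empty_iff.2 fun X hX hTX => hj ?_
      rw [← (mem_powersetCard.1 hX).2]
      exact card_le_card hTX
    rw [h0]
    simp only [card_empty, Nat.cast_zero]
    positivity

lemma sum_one_add_pow_card_inter_le {α : Type} [DecidableEq α] {E S : Finset α} {m : ℕ} {t : ℝ}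
    (hS : S ⊆ E) (hm : m ≤ E.card) (hE : 0 < E.card) (ht : 0 ≤ t) :
    ∑ X ∈ E.powersetCard m, (1 + t) ^ (S ∩ X).card ≤
      (E.card.choose m : ℝ) * Real.exp (t * (m * (S.card / E.card))) := by
  have hexp (n : ℕ) (u : ℝ) (U : Finset α) (hU : U.card = n) :
      ∑ T ∈ U.powerset, u ^ T.card = (1 + u) ^ n := by
    rw [← hU, add_comm 1 u, ← sum_pow_mul_eq_add_pow]
    simp
  calc ∑ X ∈ E.powersetCard m, (1 + t) ^ (S ∩ X).card
      = ∑ X ∈ E.powersetCard m, ∑ T ∈ S.powerset, if T ⊆ X then t ^ T.card else 0 := by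
        refine sum_congr rfl fun X _ => ?_
        rw [← hexp _ t (S ∩ X) rfl, ← sum_filter]
        refine sum_congr ?_ fun _ _ => rfl
        ext T
        simp only [mem_powerset, mem_filter, subset_inter_iff]
    _ = ∑ T ∈ S.powerset, ((E.powersetCard m).filter (T ⊆ ·)).card * t ^ T.card := by
        rw [sum_comm]
        refine sum_congr rfl fun T _ => ?_
        rw [← sum_filter, sum_const, nsmul_eq_mul]
    _ ≤ ∑ T ∈ S.powerset, (E.card.choose m : ℝ) * (t * (m / E.card)) ^ T.card := by
        refine sum_le_sum fun T hT => ?_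
        have h := card_powersetCard_filter_superset_le ((mem_powerset.1 hT).trans hS) hm hE
        calc _ ≤ (E.card.choose m : ℝ) * ((m : ℝ) / E.card) ^ T.card * t ^ T.card := by gcongr
          _ = _ := by rw [mul_pow]; ring
    _ = (E.card.choose m : ℝ) * (1 + t * (m / E.card)) ^ S.card := by
        rw [← mul_sum, hexp _ _ S rfl]
    _ ≤ (E.card.choose m : ℝ) * Real.exp (t * (m / E.card)) ^ S.card := by
        gcongr
        rw [add_comm]
        exact Real.add_one_le_exp _
    _ = _ := by
        rw [← Real.exp_nat_mul]
        congr 2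
        ring

lemma exp_sub_sq_le_one_add {t : ℝ} (ht : 0 ≤ t) : Real.exp (t - t ^ 2 / 2) ≤ 1 + t := by
  rw [← Real.le_log_iff_exp_le (by linarith)]
  refine le_trans ?_ (Real.le_log_one_add_of_nonneg ht)
  rw [le_div_iff₀ (by linarith)]
  nlinarith [pow_nonneg ht 3]

/-- Chernoff bound for the upper tail of the hypergeometric distribution. -/
lemma card_upper_tail_mul_exp_le {α : Type} [DecidableEq α] {E S : Finset α} {m : ℕ} {δ : ℝ}
    (hS : S ⊆ E) (hm : m ≤ E.card) (hE : 0 < E.card) (hδ : 0 ≤ δ) :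
    (((E.powersetCard m).filter
      (fun X => m * ((S.card : ℝ) / E.card) + δ * m < (S ∩ X).card)).card : ℝ) *
        Real.exp (m * δ ^ 2 / 2) ≤ E.card.choose m := by
  set σ : ℝ := (S.card : ℝ) / E.card
  set bad := (E.powersetCard m).filter (fun X => m * σ + δ * m < ((S ∩ X).card : ℝ))
  have h1 : (bad.card : ℝ) * Real.exp (δ * (m * σ) + m * δ ^ 2 / 2) ≤
      ∑ X ∈ E.powersetCard m, (1 + δ) ^ (S ∩ X).card := by
    calc (bad.card : ℝ) * Real.exp (δ * (m * σ) + m * δ ^ 2 / 2)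
        = ∑ X ∈ bad, Real.exp (δ * (m * σ) + m * δ ^ 2 / 2) := by
          rw [sum_const, nsmul_eq_mul]
      _ ≤ ∑ X ∈ bad, (1 + δ) ^ (S ∩ X).card := by
          refine sum_le_sum fun X hX => ?_
          obtain ⟨hX, hlt⟩ := mem_filter.1 hX
          have hle : ((S ∩ X).card : ℝ) ≤ m := by
            rw [← (mem_powersetCard.1 hX).2]
            exact_mod_cast card_le_card inter_subset_right
          refine le_trans ?_ (pow_le_pow_left₀ (Real.exp_pos _).le (exp_sub_sq_le_one_add hδ) _)
          rw [← Real.exp_nat_mul]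
          refine Real.exp_le_exp.2 ?_
          nlinarith [mul_le_mul_of_nonneg_left hlt.le hδ,
            mul_le_mul_of_nonneg_left hle (sq_nonneg δ)]
      _ ≤ _ := sum_le_sum_of_subset_of_nonneg (filter_subset _ _) fun _ _ _ => by positivity
  have h2 := h1.trans (sum_one_add_pow_card_inter_le hS hm hE hδ)
  rw [Real.exp_add] at h2
  refine le_of_mul_le_mul_right ?_ (Real.exp_pos (δ * (m * σ)))
  linarith

/-- Some `m`-subset of `E` meets every member of a not too large family of subsets in
nearly the expected proportion. -/
lemma exists_subset_card_inter_near {α : Type} [DecidableEq α] {E : Finset α} {m : ℕ} {δ : ℝ}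
    (hm : m ≤ E.card) (hE : 0 < E.card) (hδ : 0 ≤ δ)
    (F : Finset (Finset α)) (hF : ∀ S ∈ F, S ⊆ E)
    (hcard : 2 * (F.card : ℝ) < Real.exp (m * δ ^ 2 / 2)) :
    ∃ X ⊆ E, X.card = m ∧
      ∀ S ∈ F, |((S ∩ X).card : ℝ) - m * ((S.card : ℝ) / E.card)| ≤ δ * m := by
  by_contra! hcon
  let bad (S : Finset α) := (E.powersetCard m).filter
    (fun X => m * ((S.card : ℝ) / E.card) + δ * m < ((S ∩ X).card : ℝ))
  have hE' : (E.card : ℝ) ≠ 0 := by positivity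
  have hcover : E.powersetCard m ⊆ F.biUnion fun S => bad S ∪ bad (E \ S) := by
    intro X hX
    obtain ⟨hXE, hXm⟩ := mem_powersetCard.1 hX
    obtain ⟨S, hSF, hS⟩ := hcon X hXE hXm
    refine mem_biUnion.2 ⟨S, hSF, mem_union.2 ?_⟩
    rcases lt_abs.1 hS with h | h
    · exact Or.inl (mem_filter.2 ⟨hX, by linarith⟩)
    · refine Or.inr (mem_filter.2 ⟨hX, ?_⟩)
      have h1 : (((E \ S).card : ℕ) : ℝ) = E.card - S.card :=
        cast_card_sdiff (hF S hSF)
      have h2 : (((E \ S) ∩ X).card : ℝ) = m - (S ∩ X).card := by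
        have h3 : (E \ S) ∩ X = X \ S := by
          ext x
          simp only [mem_inter, mem_sdiff]
          exact ⟨fun h => ⟨h.2, h.1.2⟩, fun h => ⟨⟨hXE h.1, h.2⟩, h.1⟩⟩
        have h4 := card_sdiff_add_card_inter X S
        rw [h3, inter_comm, ← hXm, ← h4]
        push_cast
        ring
      rw [h1, h2, sub_div, div_self hE']
      linarith
  have hpos : (0 : ℝ) < E.card.choose m := by exact_mod_cast Nat.choose_pos hm
  have hsum : (E.card.choose m : ℝ) ≤ ∑ S ∈ F, (((bad S).card : ℝ) + (bad (E \ S)).card) := by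
    rw [← card_powersetCard]
    have h := (card_le_card hcover).trans
      (card_biUnion_le.trans (sum_le_sum fun S _ => card_union_le (bad S) (bad (E \ S))))
    exact_mod_cast h
  have hlt : (E.card.choose m : ℝ) * Real.exp (m * δ ^ 2 / 2) ≤
      E.card.choose m * (2 * F.card) := by
    calc _ ≤ (∑ S ∈ F, (((bad S).card : ℝ) + (bad (E \ S)).card)) *
          Real.exp (m * δ ^ 2 / 2) := by gcongr
      _ = ∑ S ∈ F, ((bad S).card * Real.exp (m * δ ^ 2 / 2) +
          (bad (E \ S)).card * Real.exp (m * δ ^ 2 / 2)) := by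
        rw [sum_mul]
        exact sum_congr rfl fun _ _ => by ring
      _ ≤ ∑ S ∈ F, ((E.card.choose m : ℝ) + E.card.choose m) :=
        sum_le_sum fun S hS => add_le_add
          (card_upper_tail_mul_exp_le (hF S hS) hm hE hδ)
          (card_upper_tail_mul_exp_le sdiff_subset hm hE hδ)
      _ = _ := by rw [sum_const, nsmul_eq_mul]; ring
  exact absurd (le_of_mul_le_mul_left hlt hpos) (not_le.2 hcard)

lemma bipCount_univ {V₁ V₂ : Type} [Fintype V₁] [Fintype V₂] (E : Finset (V₁ × V₂)) :
    bipCount E univ univ = E.card := by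
  simp [bipCount]

theorem statement_6 :
    ∀ ε : ℝ, 0 < ε → ε < 1 / 6 →
      ∃ C : ℝ, 0 < C ∧
        ∀ (V₁ V₂ : Type) (_ : Fintype V₁) (_ : Fintype V₂)
          (E : Finset (V₁ × V₂)),
          BipRegular ε Finset.univ Finset.univ E →
          ∀ m : ℕ, C * ((Fintype.card V₁ : ℝ) + (Fintype.card V₂ : ℝ)) ≤ (m : ℝ) →
            m ≤ E.card →
            ∃ E' ⊆ E, E'.card = m ∧ BipRegular (2 * ε) Finset.univ Finset.univ E' := by
  intro ε hε hε6
  set δ : ℝ := 4 * ε ^ 3 with hδ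
  have hδ0 : 0 < δ := by positivity
  refine ⟨4 / δ ^ 2, by positivity, fun V₁ V₂ _ _ E hreg m hCm hmE => ?_⟩
  rcases Nat.eq_zero_or_pos m with rfl | hm
  · exact ⟨∅, empty_subset _, rfl, fun A _ B _ _ _ => by simp [bipCount]⟩
  have hN : 0 < E.card := hm.trans_le hmE
  obtain ⟨e, -⟩ := card_pos.1 hN
  have hn₁ : 0 < Fintype.card V₁ := Fintype.card_pos_iff.2 ⟨e.1⟩
  have hn₂ : 0 < Fintype.card V₂ := Fintype.card_pos_iff.2 ⟨e.2⟩
  have hn₁' : (0 : ℝ) < Fintype.card V₁ := by exact_mod_cast hn₁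
  have hn₂' : (0 : ℝ) < Fintype.card V₂ := by exact_mod_cast hn₂
  have hN' : (0 : ℝ) < E.card := by exact_mod_cast hN
  let F : Finset (Finset (V₁ × V₂)) := (univ : Finset (Finset V₁ × Finset V₂)).image
    fun P => E.filter fun e => e.1 ∈ P.1 ∧ e.2 ∈ P.2
  have hFcard : F.card ≤ 2 ^ (Fintype.card V₁ + Fintype.card V₂) := by
    refine card_image_le.trans ?_
    simp [pow_add]
  have hcard : 2 * (F.card : ℝ) < Real.exp (m * δ ^ 2 / 2) := by
    have h1 : (2 : ℝ) * F.card ≤ 2 ^ (2 * (Fintype.card V₁ + Fintype.card V₂)) := by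
      have h2 : 2 * F.card ≤ 2 ^ (2 * (Fintype.card V₁ + Fintype.card V₂)) :=
        calc 2 * F.card ≤ 2 * 2 ^ (Fintype.card V₁ + Fintype.card V₂) := by gcongr
          _ = 2 ^ (Fintype.card V₁ + Fintype.card V₂ + 1) := by rw [pow_succ, mul_comm]
          _ ≤ _ := Nat.pow_le_pow_right (by norm_num) (by omega)
      exact_mod_cast h2
    have h3 : (2 : ℝ) ^ (2 * (Fintype.card V₁ + Fintype.card V₂)) <
        Real.exp 1 ^ (2 * (Fintype.card V₁ + Fintype.card V₂)) :=
      pow_lt_pow_left₀ (by linarith [Real.exp_one_gt_d9]) (by norm_num) (by omega)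
    refine (h1.trans_lt h3).trans_le ?_
    rw [← Real.exp_nat_mul]
    refine Real.exp_le_exp.2 ?_
    rw [div_mul_eq_mul_div, div_le_iff₀ (by positivity)] at hCm
    push_cast
    linarith
  obtain ⟨X, hXE, hXm, hX⟩ := exists_subset_card_inter_near hmE hN hδ0.le F
    (fun S hS => by
      obtain ⟨P, -, rfl⟩ := mem_image.1 hS
      exact filter_subset _ _) hcard
  refine ⟨X, hXE, hXm, fun A hA B hB hAc hBc => ?_⟩
  have hweak {x y : ℝ} (hx : 0 ≤ x) (h : 2 * ε * x ≤ y) : ε * x ≤ y := by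
    linarith [mul_nonneg hε.le hx]
  have hr := hreg A hA B hB (hweak (Nat.cast_nonneg _) hAc) (hweak (Nat.cast_nonneg _) hBc)
  have hd := hX (E.filter fun e => e.1 ∈ A ∧ e.2 ∈ B) (mem_image.2 ⟨(A, B), mem_univ _, rfl⟩)
  have hcount : ((E.filter fun e => e.1 ∈ A ∧ e.2 ∈ B) ∩ X).card = bipCount X A B := by
    unfold bipCount
    congr 1
    ext e
    simp only [mem_inter, mem_filter]
    exact ⟨fun h => ⟨h.2, h.1.2⟩, fun h => ⟨⟨hXE h.1, h.2⟩, h.1⟩⟩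
  have hcountE : (E.filter fun e => e.1 ∈ A ∧ e.2 ∈ B).card = bipCount E A B := rfl
  rw [hcount, hcountE] at hd
  rw [bipCount_univ, hXm]
  rw [bipCount_univ] at hr
  simp only [card_univ] at hr hAc hBc ⊢
  set n₁ : ℝ := (Fintype.card V₁ : ℝ)
  set n₂ : ℝ := (Fintype.card V₂ : ℝ)
  set q : ℝ := (A.card : ℝ) * B.card / (n₁ * n₂) with hq
  have hform (x : ℝ) : (A.card : ℝ) * B.card * (x / (n₁ * n₂)) = q * x := by rw [hq]; ring
  rw [hform] at hr ⊢
  have hm' : (0 : ℝ) < m := by exact_mod_cast hm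
  have hqε : 4 * ε ^ 2 ≤ q := by
    rw [hq, le_div_iff₀ (by positivity)]
    calc 4 * ε ^ 2 * (n₁ * n₂) = (2 * ε * n₁) * (2 * ε * n₂) := by ring
      _ ≤ _ := by gcongr
  have hδq : δ * m ≤ ε * q * m := by
    gcongr
    rw [hδ]
    nlinarith
  have hscale : |m * ((bipCount E A B : ℝ) / E.card) - q * m| ≤ ε * (q * m) := by
    have h1 : m * ((bipCount E A B : ℝ) / E.card) - q * m =
        (bipCount E A B - q * E.card) * (m / E.card) := by
      field_simp
    rw [h1, abs_mul, abs_of_pos (div_pos hm' hN')]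
    calc _ ≤ ε * (q * E.card) * (m / E.card) := by gcongr
      _ = _ := by field_simp
  calc _ ≤ _ := abs_sub_le _ (m * ((bipCount E A B : ℝ) / E.card)) _
    _ ≤ δ * m + ε * (q * m) := add_le_add hd hscale
    _ ≤ _ := by linarith
end
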